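/- Suppose E is a hyper-Borel-finite countable Borel equivalence relation on 2^ω. Then there exists an injective Borel function f : 2^ω → 2^ω such that for all x_0, x_1 ∈ 2^ω: (1) if x_0 E x_1, then f(x_0) ≡₁ f(x_1); (2) if ¬(x_0 E x_1), then ¬(f(x_0) ≡_m f(x_1)); (3) for every noncomputable x, f(x) is ≤_m-incomparable with both x and its complement x̄ (i.e., none of f(x) ≤_m x, x ≤_m f(x), f(x) ≤_m x̄, x̄ ≤_m f(x) hold); and (4) for every x ∈ 2^ω, there does not exist an infinite sequence (x_i)_{i∈ω} of distinct elements of the E-class of x such that f(x) ≥_m ⊕_i f(x_i). -/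

import Mathlib

open scoped Classical

namespace SlamanSteel

/-- Partial recursive functions relative to an oracle `O : ℕ → ℕ`
(Mathlib's `Nat.Partrec` with an extra oracle clause). -/
inductive RecursiveIn (O : ℕ → ℕ) : (ℕ →. ℕ) → Prop
  | zero : RecursiveIn O (pure 0)
  | succ : RecursiveIn O fun n : ℕ => Part.some (Nat.succ n)
  | left : RecursiveIn O fun n : ℕ => Part.some (Nat.unpair n).1
  | right : RecursiveIn O fun n : ℕ => Part.some (Nat.unpair n).2
  | oracle : RecursiveIn O fun n : ℕ => Part.some (O n)
  | pair {f g : ℕ →. ℕ} : RecursiveIn O f → RecursiveIn O g →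
      RecursiveIn O fun n => Nat.pair <$> f n <*> g n
  | comp {f g : ℕ →. ℕ} : RecursiveIn O f → RecursiveIn O g →
      RecursiveIn O fun n => g n >>= f
  | prec {f g : ℕ →. ℕ} : RecursiveIn O f → RecursiveIn O g →
      RecursiveIn O (Nat.unpaired fun a n =>
        n.rec (f a) fun y IH => do { let i ← IH; g (Nat.pair a (Nat.pair y i)) })
  | rfind {f : ℕ →. ℕ} : RecursiveIn O f →
      RecursiveIn O fun a => Nat.rfind fun n => (fun m => m = 0) <$> f (Nat.pair a n)

/-- The oracle (as a function `ℕ → ℕ`) associated to a real `x ∈ 2^ω`. -/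
def oracleOf (x : ℕ → Bool) : ℕ → ℕ := fun n => cond (x n) 1 0

/-- `z ≤_T x` : `z` is computable relative to the oracle `x`. -/
def TuringLE (z x : ℕ → Bool) : Prop :=
  RecursiveIn (oracleOf x) fun n => Part.some (oracleOf z n)

/-- Turing equivalence on `2^ω`. -/
def TuringEquiv (x y : ℕ → Bool) : Prop := TuringLE x y ∧ TuringLE y x

/-- The `j`th column of `y ∈ 2^ω`. -/
def column (y : ℕ → Bool) (j : ℕ) : ℕ → Bool := fun m => y (Nat.pair j m)

/-- `x ≤_m y` : many-one reducibility on `2^ω`. -/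
def MLE (x y : ℕ → Bool) : Prop :=
  ∃ ρ : ℕ → ℕ, Computable ρ ∧ ∀ n, x n = y (ρ n)

/-- `x ≡_m y` : many-one equivalence on `2^ω`. -/
def MEquiv (x y : ℕ → Bool) : Prop := MLE x y ∧ MLE y x

/-- `x ≤₁ y` : one-one reducibility on `2^ω`. -/
def OneLE (x y : ℕ → Bool) : Prop :=
  ∃ ρ : ℕ → ℕ, Computable ρ ∧ Function.Injective ρ ∧ ∀ n, x n = y (ρ n)

/-- `x ≡₁ y` : one-one equivalence on `2^ω`. -/
def OneEquiv (x y : ℕ → Bool) : Prop := OneLE x y ∧ OneLE y x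

/-- The complement `x̄` of a real, flipping every bit. -/
def flipBits (x : ℕ → Bool) : ℕ → Bool := fun n => !(x n)

/-- The computable join `⊕_i z_i` of a sequence of reals: `(⊕_i z_i)(⟨i,m⟩) = z_i(m)`. -/
def joinSeq (z : ℕ → ℕ → Bool) : ℕ → Bool :=
  fun k => z (Nat.unpair k).1 (Nat.unpair k).2

/-- The computable join of finitely many reals. -/
def joinFin {n : ℕ} (z : Fin n → ℕ → Bool) : ℕ → Bool := fun k =>
  if h : (Nat.unpair k).1 < n then z ⟨(Nat.unpair k).1, h⟩ (Nat.unpair k).2 else false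

/-- The initial segment of `x` of length `k`, as a binary string. -/
def initSeg (x : ℕ → Bool) (k : ℕ) : List Bool := (List.range k).map x

/-- `W` is a set of strings which is computably enumerable relative to the oracle `x`. -/
def CEIn (x : ℕ → Bool) (W : Set (List Bool)) : Prop :=
  ∃ f : ℕ →. ℕ, RecursiveIn (oracleOf x) f ∧
    ∀ σ : List Bool, σ ∈ W ↔ (f (Encodable.encode σ)).Dom

/-- `g` is `x`-generic (1-generic relative to `x`). -/
def GenericIn (x g : ℕ → Bool) : Prop :=
  ∀ W : Set (List Bool), CEIn x W →
    ∃ k, initSeg g k ∈ W ∨ ∀ τ : List Bool, initSeg g k <+: τ → τ ∉ W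

/-- `g` is 1-generic. -/
def OneGeneric (g : ℕ → Bool) : Prop := GenericIn (fun _ => false) g

/-- Reals `z 0, …, z (n-1)` are mutually 1-generic if their join is 1-generic. -/
def MutuallyOneGeneric {n : ℕ} (z : Fin n → ℕ → Bool) : Prop := OneGeneric (joinFin z)

/-- `E` is hyper-`(f_i)`-finite: `E` is an increasing union of Borel subequivalence
relations none of which has a class containing an infinite set `{f i x j : j ∈ ω}`. -/
def HyperFinWrt {X : Type*} [MeasurableSpace X] (E : X → X → Prop)
    (f : ℕ → X → ℕ → X) : Prop :=
  ∃ F : ℕ → X → X → Prop,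
    (∀ n, Equivalence (F n)) ∧
    (∀ n, MeasurableSet {p : X × X | F n p.1 p.2}) ∧
    (∀ n a b, F n a b → F (n + 1) a b) ∧
    (∀ a b, E a b ↔ ∃ n, F n a b) ∧
    (∀ n x i, (Set.range (f i x)).Infinite → ¬ Set.range (f i x) ⊆ {y | F n x y})

/-- `E` is hyper-Borel-finite: hyper-`(f_i)`-finite for every countable sequence of
Borel functions `f_i : X → X^ω`. -/
def HyperBorelFinite {X : Type*} [MeasurableSpace X] (E : X → X → Prop) : Prop :=
  ∀ f : ℕ → X → ℕ → X, (∀ i, Measurable (f i)) → HyperFinWrt E f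

/-- Turing equivalence is hyper-recursively-finite: it is an increasing union of Borel
equivalence relations `F n` such that no `F n`-class of `x` contains, as an infinite
subset, the set of columns of some `y ≤_T x`. -/
def HyperRecFin : Prop :=
  ∃ F : ℕ → (ℕ → Bool) → (ℕ → Bool) → Prop,
    (∀ n, Equivalence (F n)) ∧
    (∀ n, MeasurableSet {p : (ℕ → Bool) × (ℕ → Bool) | F n p.1 p.2}) ∧
    (∀ n a b, F n a b → F (n + 1) a b) ∧
    (∀ a b, TuringEquiv a b ↔ ∃ n, F n a b) ∧
    (∀ n x y, TuringLE y x → (Set.range (column y)).Infinite →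
      ¬ Set.range (column y) ⊆ {z | F n x z})

theorem measurableSet_forall {W : Type*} {ι : Sort*} [MeasurableSpace W] [Countable ι] {p : ι → W → Prop}
    (h : ∀ i, MeasurableSet {z | p i z}) : MeasurableSet {z | ∀ i, p i z} := by
  rw [Set.ofPred_forall]; exact MeasurableSet.iInter h

theorem measurableSet_exists {W : Type*} {ι : Sort*} [MeasurableSpace W] [Countable ι] {p : ι → W → Prop}
    (h : ∀ i, MeasurableSet {z | p i z}) : MeasurableSet {z | ∃ i, p i z} := by
  rw [Set.ofPred_exists]; exact MeasurableSet.iUnion h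

theorem measurableSet_and {W : Type*} [MeasurableSpace W] {p q : W → Prop}
    (h : MeasurableSet {z | p z}) (h' : MeasurableSet {z | q z}) :
    MeasurableSet {z | p z ∧ q z} := h.inter h'

theorem measurableSet_not {W : Type*} [MeasurableSpace W] {p : W → Prop}
    (h : MeasurableSet {z | p z}) : MeasurableSet {z | ¬ p z} := h.compl

theorem exists_measurable_extension {W : Type*} [TopologicalSpace W] [PolishSpace W]
    [MeasurableSpace W] [BorelSpace W] {C : Set W} (hC : MeasurableSet C)
    {a y : W → ℕ → Bool} (ha : Measurable a) (hy : Measurable y)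
    (h : ∀ c ∈ C, ∀ c' ∈ C, a c = a c' → y c = y c') :
    ∃ φ : (ℕ → Bool) → ℕ → Bool, Measurable φ ∧ ∀ c ∈ C, φ (a c) = y c := by
  have hsep : ∀ k : ℕ, ∃ u : Set (ℕ → Bool), MeasurableSet u ∧
      ∀ c ∈ C, (a c ∈ u ↔ y c k = true) := by
    intro k
    have hyk : Measurable fun c => y c k := (measurable_pi_apply k).comp hy
    have h1 : MeasureTheory.AnalyticSet (a '' (C ∩ {c | y c k = true})) :=
      (hC.inter (measurableSet_eq_fun hyk measurable_const)).analyticSet_image ha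
    have h2 : MeasureTheory.AnalyticSet (a '' (C ∩ {c | y c k = false})) :=
      (hC.inter (measurableSet_eq_fun hyk measurable_const)).analyticSet_image ha
    have hd : Disjoint (a '' (C ∩ {c | y c k = true})) (a '' (C ∩ {c | y c k = false})) := by
      rw [Set.disjoint_left]
      rintro _ ⟨c, ⟨hc, hck⟩, rfl⟩ ⟨c', ⟨hc', hck'⟩, he⟩
      have := h c hc c' hc' he.symm
      simp_all
    obtain ⟨u, hu, hdu, hm⟩ := h1.measurablySeparable h2 hd
    refine ⟨u, hm, fun c hc => ⟨fun hcu => ?_, fun hck => hu ⟨c, ⟨hc, hck⟩, rfl⟩⟩⟩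
    by_contra hne
    exact Set.disjoint_left.1 hdu ⟨c, ⟨hc, by simpa using hne⟩, rfl⟩ hcu
  choose u hum hu using hsep
  refine ⟨fun x k => decide (x ∈ u k), ?_, fun c hc => ?_⟩
  · refine measurable_pi_lambda _ fun k => ?_
    have : (fun x => decide (x ∈ u k)) = fun x => if x ∈ u k then true else false := by
      funext x; by_cases hx : x ∈ u k <;> simp [hx]
    rw [this]
    exact Measurable.ite (hum k) measurable_const measurable_const
  · funext k
    rw [Bool.eq_iff_iff, ← hu k c hc]
    simp

/-- Tuples of points of Baire space that agree with `w` below `N` in the first `n` coordinates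
and whose images under `h` lie on one vertical line. -/
def lineTuples (h : (ℕ → ℕ) → (ℕ → Bool) × (ℕ → Bool)) (n N : ℕ) (w : ℕ → ℕ → ℕ) :
    Set (ℕ → ℕ → ℕ) :=
  {z | ∀ i < n, (∀ r < N, z i r = w i r) ∧ (h (z i)).1 = (h (z 0)).1}

/-- Some sequence of Borel functions meets each tuple in `lineTuples h n N w`. -/
def LineSmall (h : (ℕ → ℕ) → (ℕ → Bool) × (ℕ → Bool)) (n N : ℕ) (w : ℕ → ℕ → ℕ) : Prop :=
  ∃ ψ : ℕ → (ℕ → Bool) → ℕ → Bool, (∀ j, Measurable (ψ j)) ∧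
    ∀ z ∈ lineTuples h n N w, ∃ i < n, ∃ j, ψ j (h (z i)).1 = (h (z i)).2

theorem lineTuples_congr {h : (ℕ → ℕ) → (ℕ → Bool) × (ℕ → Bool)} {n N : ℕ} {w w' : ℕ → ℕ → ℕ}
    (hw : ∀ i < n, ∀ r < N, w i r = w' i r) : lineTuples h n N w = lineTuples h n N w' := by
  ext z
  refine forall₂_congr fun i hi => and_congr_left fun _ => forall₂_congr fun r hr => ?_
  rw [hw i hi r hr]

theorem measurableSet_lineTuples {h : (ℕ → ℕ) → (ℕ → Bool) × (ℕ → Bool)} (hh : Continuous h)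
    (n N : ℕ) (w : ℕ → ℕ → ℕ) : MeasurableSet (lineTuples h n N w) := by
  have hm : Measurable h := hh.measurable
  unfold lineTuples
  refine measurableSet_forall fun i => measurableSet_forall fun _ => measurableSet_and ?_ ?_
  · refine measurableSet_forall fun r => measurableSet_forall fun _ => ?_
    exact measurableSet_eq_fun (by fun_prop) measurable_const
  · exact measurableSet_eq_fun (by fun_prop) (by fun_prop)

theorem exists_uniform_lineSmall (h : (ℕ → ℕ) → (ℕ → Bool) × (ℕ → Bool)) :
    ∃ Φ : ℕ → (ℕ → Bool) → ℕ → Bool, (∀ j, Measurable (Φ j)) ∧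
      ∀ n N w, LineSmall h n N w → ∀ z ∈ lineTuples h n N w,
        ∃ i < n, ∃ j, Φ j (h (z i)).1 = (h (z i)).2 := by
  let ext : (p : Σ n N : ℕ, Fin n → Fin N → ℕ) → ℕ → ℕ → ℕ := fun p i r =>
    if hi : i < p.1 then if hr : r < p.2.1 then p.2.2 ⟨i, hi⟩ ⟨r, hr⟩ else 0 else 0
  have hsel : ∀ p : Σ n N : ℕ, Fin n → Fin N → ℕ, ∃ ψ : ℕ → (ℕ → Bool) → ℕ → Bool,
      (∀ j, Measurable (ψ j)) ∧ (LineSmall h p.1 p.2.1 (ext p) →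
        ∀ z ∈ lineTuples h p.1 p.2.1 (ext p), ∃ i < p.1, ∃ j, ψ j (h (z i)).1 = (h (z i)).2) := by
    intro p
    by_cases hp : LineSmall h p.1 p.2.1 (ext p)
    · obtain ⟨ψ, h1, h2⟩ := hp
      exact ⟨ψ, h1, fun _ => h2⟩
    · exact ⟨fun _ => id, fun _ => measurable_id, fun hp' => absurd hp' hp⟩
  choose ψ hψm hψ using hsel
  have : Nonempty ((Σ n N : ℕ, Fin n → Fin N → ℕ) × ℕ) := ⟨⟨⟨0, 0, fun _ _ => 0⟩, 0⟩⟩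
  obtain ⟨e, he⟩ := exists_surjective_nat ((Σ n N : ℕ, Fin n → Fin N → ℕ) × ℕ)
  refine ⟨fun k => ψ (e k).1 (e k).2, fun k => hψm _ _, fun n N w hw z hz => ?_⟩
  let p : Σ n N : ℕ, Fin n → Fin N → ℕ := ⟨n, N, fun i r => w i r⟩
  have hpw : lineTuples h n N w = lineTuples h p.1 p.2.1 (ext p) := by
    refine lineTuples_congr fun i hi r hr => ?_
    simp [ext, p, hi, hr]
  have hs : LineSmall h p.1 p.2.1 (ext p) := by
    unfold LineSmall at hw ⊢
    rwa [← hpw]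
  obtain ⟨i, hi, j, hj⟩ := hψ p hs z (hpw ▸ hz)
  obtain ⟨k, hk⟩ := he (p, j)
  exact ⟨i, hi, k, by simpa only [hk] using hj⟩

theorem exists_split_of_not_lineSmall {h : (ℕ → ℕ) → (ℕ → Bool) × (ℕ → Bool)}
    (hh : Continuous h) {n N : ℕ} {w : ℕ → ℕ → ℕ} (hw : ¬ LineSmall h n N w) {i : ℕ} (hi : i < n) :
    ∃ N' > N, ∃ w' : ℕ → ℕ → ℕ, ¬ LineSmall h (n + 1) N' w' ∧
      (∀ l < n, ∀ r < N, w' l r = w l r) ∧ (∀ r < N, w' n r = w i r) ∧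
      ∀ ζ ζ' : ℕ → ℕ, (∀ r < N', ζ r = w' i r) → (∀ r < N', ζ' r = w' n r) →
        (h ζ).2 ≠ (h ζ').2 := by
  obtain ⟨Φ, hΦm, hΦ⟩ := exists_uniform_lineSmall h
  have hm : Measurable h := hh.measurable
  set C : Set (ℕ → ℕ → ℕ) := {z | z ∈ lineTuples h n N w ∧
    ∀ l < n, ∀ j, Φ j (h (z l)).1 ≠ (h (z l)).2} with hCdef
  have hC : MeasurableSet C := by
    refine (measurableSet_lineTuples hh n N w).inter ?_
    refine measurableSet_forall fun l => measurableSet_forall fun _ =>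
      measurableSet_forall fun j => measurableSet_not (measurableSet_eq_fun ?_ ?_)
    · exact (hΦm j).comp (by fun_prop)
    · fun_prop
  have hnf : ¬ ∀ c ∈ C, ∀ c' ∈ C, (h (c i)).1 = (h (c' i)).1 → (h (c i)).2 = (h (c' i)).2 := by
    intro hf
    obtain ⟨φ, hφm, hφ⟩ := exists_measurable_extension hC (a := fun c => (h (c i)).1)
      (y := fun c => (h (c i)).2) (by fun_prop) (by fun_prop) hf
    refine hw ⟨fun j => Nat.casesOn j φ Φ, fun j => ?_, fun z hz => ?_⟩
    · cases j
      · exact hφm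
      · exact hΦm _
    · by_cases hzC : z ∈ C
      · exact ⟨i, hi, 0, hφ z hzC⟩
      · simp only [hCdef, Set.mem_ofPred_eq, not_and, not_forall, not_not] at hzC
        obtain ⟨l, hl, j, hj⟩ := hzC hz
        exact ⟨l, hl, j + 1, hj⟩
  push Not at hnf
  obtain ⟨c, hc, c', hc', he, hne⟩ := hnf
  let w' : ℕ → ℕ → ℕ := fun l => if l < n then c l else c' i
  have hw'1 : ∀ l < n, w' l = c l := fun l hl => by simp [w', hl]
  have hw'2 : w' n = c' i := by simp [w']
  obtain ⟨M, hM⟩ : ∃ M, ∀ ζ ζ' : ℕ → ℕ, (∀ r < M, ζ r = c i r) → (∀ r < M, ζ' r = c' i r) →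
      (h ζ).2 ≠ (h ζ').2 := by
    obtain ⟨k, hk⟩ := Function.ne_iff.1 hne
    have hcont : Continuous fun ζ => (h ζ).2 k := (continuous_apply k).comp (continuous_snd.comp hh)
    have hloc : ∀ a : ℕ → ℕ, ∃ M, ∀ ζ : ℕ → ℕ, (∀ r < M, ζ r = a r) → (h ζ).2 k = (h a).2 k := by
      intro a
      have ho : IsOpen {ζ : ℕ → ℕ | (h ζ).2 k = (h a).2 k} :=
        (isOpen_discrete {(h a).2 k}).preimage hcont
      obtain ⟨ε, hε, hb⟩ := (PiNat.isOpen_iff_dist _).1 ho a rfl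
      obtain ⟨M, hM⟩ := exists_pow_lt_of_lt_one hε (by norm_num : (1 / 2 : ℝ) < 1)
      refine ⟨M, fun ζ hζ => hb ζ (lt_of_le_of_lt ?_ hM)⟩
      rw [PiNat.dist_comm]
      exact PiNat.mem_cylinder_iff_dist_le.1 hζ
    obtain ⟨M₁, h₁⟩ := hloc (c i)
    obtain ⟨M₂, h₂⟩ := hloc (c' i)
    refine ⟨max M₁ M₂, fun ζ ζ' hζ hζ' heq => hk ?_⟩
    rw [← h₁ ζ fun r hr => hζ r (lt_max_of_lt_left hr),
      ← h₂ ζ' fun r hr => hζ' r (lt_max_of_lt_right hr), heq]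
  have hline : w' ∈ lineTuples h (n + 1) (max (N + 1) M) w' := by
    have h0 : w' 0 = c 0 := hw'1 0 (by omega)
    intro l hl
    refine ⟨fun _ _ => rfl, ?_⟩
    rw [h0]
    rcases Nat.lt_succ_iff_lt_or_eq.1 hl with hl | rfl
    · rw [hw'1 l hl]; exact (hc.1 l hl).2
    · rw [hw'2, ← he]; exact (hc.1 i hi).2
  refine ⟨max (N + 1) M, by omega, w', fun hs => ?_, fun l hl r hr => ?_, fun r hr => ?_, ?_⟩
  · obtain ⟨l, hl, j, hj⟩ := hΦ _ _ _ hs _ hline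
    rcases Nat.lt_succ_iff_lt_or_eq.1 hl with hl | rfl
    · rw [hw'1 l hl] at hj; exact hc.2 l hl j hj
    · rw [hw'2] at hj; exact hc'.2 i hi j hj
  · rw [hw'1 l hl]; exact (hc.1 l hl).1 r hr
  · rw [hw'2]; exact (hc'.1 i hi).1 r hr
  · intro ζ ζ' hζ hζ'
    rw [hw'1 i hi] at hζ
    rw [hw'2] at hζ'
    exact hM ζ ζ' (fun r hr => hζ r (lt_max_of_lt_right hr))
      fun r hr => hζ' r (lt_max_of_lt_right hr)

theorem exists_limit_of_coherent {N : ℕ → ℕ} (hN : ∀ k, k ≤ N k) {w : ℕ → ℕ → ℕ}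
    (hw : ∀ k, ∀ r < N k, w (k + 1) r = w k r) (hmono : ∀ k, N k ≤ N (k + 1)) :
    ∃ ζ : ℕ → ℕ, ∀ k, ∀ r < N k, ζ r = w k r := by
  have hmon : Monotone N := monotone_nat_of_le_succ hmono
  have hle : ∀ k k', k ≤ k' → ∀ r < N k, w k' r = w k r := by
    intro k k' hkk'
    induction hkk' with
    | refl => intros; rfl
    | step hk ih => intro r hr; rw [hw _ r (hr.trans_le (hmon hk)), ih r hr]
  refine ⟨fun r => w (r + 1) r, fun k r hr => ?_⟩
  rcases le_total k (r + 1) with hk | hk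
  · exact hle _ _ hk r hr
  · exact (hle _ _ hk r (hN (r + 1))).symm

theorem tendsto_of_agree {N : ℕ → ℕ} (hN : ∀ k, k ≤ N k) {ζ : ℕ → ℕ} {z : ℕ → ℕ → ℕ}
    (hz : ∀ k, ∀ r < N k, z k r = ζ r) : Filter.Tendsto z Filter.atTop (nhds ζ) := by
  rw [tendsto_pi_nhds]
  intro r
  refine tendsto_const_nhds.congr' ?_
  filter_upwards [Filter.eventually_gt_atTop r] with k hk
  exact (hz k r (hk.trans_le (hN k))).symm

theorem lineSmall_one_zero {h : (ℕ → ℕ) → (ℕ → Bool) × (ℕ → Bool)}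
    (hh : Continuous h) (hcount : ∀ x, {y | (x, y) ∈ Set.range h}.Countable) :
    LineSmall h 1 0 fun _ _ => 0 := by
  by_contra h0
  let P : ℕ × ℕ × (ℕ → ℕ → ℕ) → Prop := fun s => ¬ LineSmall h (s.1 + 1) s.2.1 s.2.2
  have hstep : ∀ s : {s // P s}, ∃ s' : {s // P s}, s'.1.1 = s.1.1 + 1 ∧ s.1.2.1 < s'.1.2.1 ∧
      (∀ l < s.1.1 + 1, ∀ r < s.1.2.1, s'.1.2.2 l r = s.1.2.2 l r) ∧
      (∀ r < s.1.2.1, s'.1.2.2 (s.1.1 + 1) r = s.1.2.2 (Nat.unpair s.1.1).1 r) ∧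
      ∀ ζ ζ' : ℕ → ℕ, (∀ r < s'.1.2.1, ζ r = s'.1.2.2 (Nat.unpair s.1.1).1 r) →
        (∀ r < s'.1.2.1, ζ' r = s'.1.2.2 (s.1.1 + 1) r) → (h ζ).2 ≠ (h ζ').2 := by
    rintro ⟨⟨k, N, w⟩, hs⟩
    obtain ⟨N', hN', w', h1, h2, h3, h4⟩ := exists_split_of_not_lineSmall hh hs
      (i := (Nat.unpair k).1) (Nat.lt_succ_of_le (Nat.unpair_left_le k))
    exact ⟨⟨(k + 1, N', w'), h1⟩, rfl, hN', h2, h3, h4⟩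
  choose nxt hn1 hn2 hn3 hn4 hn5 using hstep
  let S : ℕ → {s // P s} := fun k => nxt^[k] ⟨(0, 0, fun _ _ => 0), h0⟩
  have hS : ∀ k, S (k + 1) = nxt (S k) := fun k => Function.iterate_succ_apply' _ _ _
  have hSk : ∀ k, (S k).1.1 = k := by
    intro k
    induction k with
    | zero => rfl
    | succ k ih => rw [hS, hn1, ih]
  set N : ℕ → ℕ := fun k => (S k).1.2.1 with hNdef
  set w : ℕ → ℕ → ℕ → ℕ := fun k => (S k).1.2.2 with hwdef
  have hNlt : ∀ k, N k < N (k + 1) := fun k => by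
    simp only [hNdef, hS]; exact hn2 _
  have hNk : ∀ k, k ≤ N k := by
    intro k
    induction k with
    | zero => exact Nat.zero_le _
    | succ k ih => exact ih.trans_lt (hNlt k)
  have hw1 : ∀ k, ∀ l ≤ k, ∀ r < N k, w (k + 1) l r = w k l r := fun k l hl r hr => by
    simp only [hwdef, hS]; exact hn3 (S k) l (by rw [hSk]; omega) r hr
  have hw2 : ∀ k, ∀ r < N k, w (k + 1) (k + 1) r = w k (Nat.unpair k).1 r := fun k r hr => by
    have := hn4 (S k) r hr
    rw [hSk] at this
    simp only [hwdef, hS]; exact this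
  have hw3 : ∀ k, ∀ ζ ζ' : ℕ → ℕ, (∀ r < N (k + 1), ζ r = w (k + 1) (Nat.unpair k).1 r) →
      (∀ r < N (k + 1), ζ' r = w (k + 1) (k + 1) r) → (h ζ).2 ≠ (h ζ').2 := fun k ζ ζ' => by
    have := hn5 (S k) ζ ζ'
    rw [hSk] at this
    simp only [hNdef, hwdef, hS]; exact this
  have hz : ∀ k, ∃ z, z ∈ lineTuples h (k + 1) (N k) (w k) := by
    intro k
    by_contra hne
    have hP := (S k).2
    simp only [P, hSk] at hP
    exact hP ⟨fun _ => id, fun _ => measurable_id, fun z hz => absurd ⟨z, hz⟩ hne⟩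
  choose z hz using hz
  obtain ⟨ζ₀, hζ₀⟩ := exists_limit_of_coherent hNk (w := fun k => w k 0)
    (fun k => hw1 k 0 (Nat.zero_le _)) fun k => (hNlt k).le
  have hfst : ∀ (c : ℕ → ℕ) (ζ : ℕ → ℕ), (∀ k, c k ≤ k) →
      (∀ k, ∀ r < N k, ζ r = w k (c k) r) → (h ζ).1 = (h ζ₀).1 := by
    intro c ζ hc hζ
    have t1 : Filter.Tendsto (fun k => z k (c k)) Filter.atTop (nhds ζ) :=
      tendsto_of_agree hNk fun k r hr => by
        rw [((hz k) (c k) (Nat.lt_succ_of_le (hc k))).1 r hr, hζ k r hr]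
    have t2 : Filter.Tendsto (fun k => z k 0) Filter.atTop (nhds ζ₀) :=
      tendsto_of_agree hNk fun k r hr => by
        rw [((hz k) 0 (Nat.succ_pos k)).1 r hr, hζ₀ k r hr]
    have hc1 : Continuous fun ζ => (h ζ).1 := continuous_fst.comp hh
    refine tendsto_nhds_unique ((hc1.tendsto ζ).comp t1) (((hc1.tendsto ζ₀).comp t2).congr ?_)
    exact fun k => (((hz k) (c k) (Nat.lt_succ_of_le (hc k))).2).symm
  have hne : {y | ((h ζ₀).1, y) ∈ Set.range h}.Nonempty := ⟨(h ζ₀).2, ζ₀, rfl⟩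
  obtain ⟨y, hy⟩ := (hcount (h ζ₀).1).exists_eq_range hne
  have hdodge : ∀ k (u : ℕ → Bool), ∃ c', (c' = (Nat.unpair k).1 ∨ c' = k + 1) ∧
      ∀ ζ : ℕ → ℕ, (∀ r < N (k + 1), ζ r = w (k + 1) c' r) → (h ζ).2 ≠ u := by
    intro k u
    by_contra hcon
    push Not at hcon
    obtain ⟨a, ha, ha'⟩ := hcon _ (Or.inl rfl)
    obtain ⟨b, hb, hb'⟩ := hcon _ (Or.inr rfl)
    exact hw3 k a b ha hb (ha'.trans hb'.symm)
  choose d hd1 hd2 using hdodge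
  let cr : ℕ → ℕ × ℕ := fun k => Nat.rec (0, 0)
    (fun k s => if (Nat.unpair k).1 = s.1 then (d k (y s.2), s.2 + 1) else s) k
  have hcr : ∀ k, cr (k + 1) = if (Nat.unpair k).1 = (cr k).1 then
      (d k (y (cr k).2), (cr k).2 + 1) else cr k := fun k => rfl
  have hcle : ∀ k, (cr k).1 ≤ k := by
    intro k
    induction k with
    | zero => exact le_rfl
    | succ k ih =>
      rw [hcr]
      split_ifs with hk
      · rcases hd1 k (y (cr k).2) with hh' | hh' <;> simp only [hh']
        · rw [hk]; omega
        · exact le_rfl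
      · omega
  obtain ⟨ζ, hζ⟩ := exists_limit_of_coherent hNk (w := fun k => w k (cr k).1) (fun k r hr => by
    simp only [hcr]
    split_ifs with hk
    · rcases hd1 k (y (cr k).2) with hh' | hh' <;> simp only [hh']
      · rw [← hk]; exact hw1 k _ (Nat.unpair_left_le k) r hr
      · rw [← hk]; exact hw2 k r hr
    · exact hw1 k _ (hcle k) r hr) fun k => (hNlt k).le
  have hfind : ∀ k, ∃ m ≥ k, (cr m).2 = (cr k).2 ∧ (Nat.unpair m).1 = (cr m).1 := by
    intro k
    by_contra hcon
    push Not at hcon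
    have hconst : ∀ m ≥ k, cr m = cr k := by
      intro m hm
      induction m, hm using Nat.le_induction with
      | base => rfl
      | succ m hm ih => rw [hcr, if_neg (hcon m hm (by rw [ih])), ih]
    have hm := Nat.right_le_pair (cr k).1 k
    exact hcon _ hm (by rw [hconst _ hm]) (by rw [hconst _ hm, Nat.unpair_pair])
  have hall : ∀ r, ∃ m, (cr m).2 = r ∧ (Nat.unpair m).1 = (cr m).1 := by
    intro r
    induction r with
    | zero => obtain ⟨m, -, h1, h2⟩ := hfind 0; exact ⟨m, h1, h2⟩
    | succ r ih =>
      obtain ⟨m, h1, h2⟩ := ih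
      obtain ⟨m', -, h3, h4⟩ := hfind (m + 1)
      refine ⟨m', ?_, h4⟩
      rw [h3, hcr, if_pos h2, h1]
  have hmem : (h ζ).2 ∈ {y | ((h ζ₀).1, y) ∈ Set.range h} :=
    ⟨ζ, by rw [← hfst _ ζ hcle hζ]⟩
  rw [hy] at hmem
  obtain ⟨r, hr⟩ := hmem
  obtain ⟨m, h1, h2⟩ := hall r
  refine hd2 m (y (cr m).2) ζ (fun r hr => ?_) (by rw [h1, hr])
  have := hζ (m + 1) r hr
  simpa only [hcr, if_pos h2] using this

/-- Lusin–Novikov uniformization for a Borel equivalence relation with countable classes. -/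
theorem exists_measurable_enumeration {E : (ℕ → Bool) → (ℕ → Bool) → Prop} (hE : Equivalence E)
    (hEBorel : MeasurableSet {p : (ℕ → Bool) × (ℕ → Bool) | E p.1 p.2})
    (hEcount : ∀ x, {y | E x y}.Countable) :
    ∃ φ : ℕ → (ℕ → Bool) → ℕ → Bool, (∀ j, Measurable (φ j)) ∧
      ∀ x y, E x y ↔ ∃ j, φ j x = y := by
  have : PolishSpace Bool := inferInstance
  have han := hEBorel.analyticSet
  rw [MeasureTheory.AnalyticSet] at han
  rcases han with h0 | ⟨h, hh, hr⟩
  · exact absurd (hE.refl fun _ => false)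
      (fun h => (Set.eq_empty_iff_forall_notMem.1 h0) (_, _) h)
  obtain ⟨ψ, hψm, hψ⟩ := lineSmall_one_zero hh fun x => by
    rw [hr]; exact hEcount x
  refine ⟨fun j x => if E x (ψ j x) then ψ j x else x, fun j => ?_, fun x y => ⟨fun hxy => ?_, ?_⟩⟩
  · exact Measurable.ite (hEBorel.preimage (measurable_id.prodMk (hψm j))) (hψm j) measurable_id
  · obtain ⟨ζ, hζ⟩ : (x, y) ∈ Set.range h := by rw [hr]; exact hxy
    obtain ⟨i, -, j, hj⟩ := hψ (fun _ => ζ) fun i _ => ⟨fun r hr => absurd hr (Nat.not_lt_zero r), rfl⟩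
    rw [hζ] at hj
    simp only at hj
    exact ⟨j, by simp only [hj, if_pos hxy]⟩
  · rintro ⟨j, rfl⟩
    dsimp only
    split_ifs with hj
    · exact hj
    · exact hE.refl x

section Runs

variable {X : Type*} (act : ℕ → X → X)

/-- Follow the steps of a list from `z` for as long as they are allowed by `D`; return the point
reached and the remaining steps. -/
noncomputable def runOn (D : Set (X × ℕ)) : X → List ℕ → X × List ℕ
  | z, [] => (z, [])
  | z, b :: τ => if (z, b) ∈ D then runOn D (act b z) τ else (z, b :: τ)

/-- The finite stages of the closure of the allowed steps of level at most `P` under the steps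
that infinitely many tails of the sequence `p` require. -/
def stepClosure (lvl : ℕ → ℕ) (p : ℕ → List ℕ × ℕ) (P : ℕ) (w : X) : ℕ → Set (X × ℕ)
  | 0 => ∅
  | i + 1 => stepClosure lvl p P w i ∪ {e | lvl e.2 ≤ P ∧
      {θ : List ℕ × ℕ | ∃ n, runOn act (stepClosure lvl p P w i) w (p n).1 = (e.1, e.2 :: θ.1) ∧
        (p n).2 = θ.2}.Infinite}

/-- The tails of positions in the sequence `p` from the first step of level above `P` on. -/
def highTails (lvl : ℕ → ℕ) (p : ℕ → List ℕ × ℕ) (P : ℕ) : Set (ℕ × List ℕ × ℕ) :=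
  {θ | ∃ n π, (p n).1 = π ++ θ.1 :: θ.2.1 ∧ (p n).2 = θ.2.2 ∧ (∀ b ∈ π, lvl b ≤ P) ∧ P < lvl θ.1}

/-- The steps that begin infinitely many tails in some `highTails lvl p P`. -/
def highSteps (lvl : ℕ → ℕ) (p : ℕ → List ℕ × ℕ) : Set ℕ :=
  {b | ∃ P, P < lvl b ∧ {θ : List ℕ × ℕ | (b, θ) ∈ highTails lvl p P}.Infinite}

variable {act} {D D' : Set (X × ℕ)} {z w : X} {σ τ : List ℕ} {b : ℕ}

theorem runOn_cons_mem (h : (z, b) ∈ D) : runOn act D z (b :: τ) = runOn act D (act b z) τ := by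
  rw [runOn, if_pos h]

theorem runOn_cons_notMem (h : (z, b) ∉ D) : runOn act D z (b :: τ) = (z, b :: τ) := by
  rw [runOn, if_neg h]

theorem runOn_trans (h : D ⊆ D') (z : X) (σ : List ℕ) :
    runOn act D' (runOn act D z σ).1 (runOn act D z σ).2 = runOn act D' z σ := by
  induction σ generalizing z with
  | nil => simp [runOn]
  | cons b σ ih =>
    by_cases hb : (z, b) ∈ D
    · rw [runOn_cons_mem hb, runOn_cons_mem (h hb), ih]
    · rw [runOn_cons_notMem hb]

theorem notMem_of_runOn_eq_cons (h : runOn act D w σ = (z, b :: τ)) : (z, b) ∉ D := by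
  induction σ generalizing w with
  | nil => simp [runOn] at h
  | cons a σ ih =>
    by_cases ha : (w, a) ∈ D
    · rw [runOn_cons_mem ha] at h; exact ih h
    · rw [runOn_cons_notMem ha] at h
      simp only [Prod.mk.injEq, List.cons.injEq] at h
      obtain ⟨rfl, rfl, rfl⟩ := h
      exact ha

theorem exists_eq_append_runOn (z : X) (σ : List ℕ) :
    ∃ π, σ = π ++ (runOn act D z σ).2 ∧ ∀ b ∈ π, ∃ z, (z, b) ∈ D := by
  induction σ generalizing z with
  | nil => exact ⟨[], rfl, by simp⟩
  | cons a σ ih =>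
    by_cases ha : (z, a) ∈ D
    · obtain ⟨π, h1, h2⟩ := ih (act a z)
      refine ⟨a :: π, ?_, ?_⟩
      · rw [runOn_cons_mem ha, List.cons_append, ← h1]
      · intro b hb
        rcases List.mem_cons.1 hb with rfl | hb
        · exact ⟨z, ha⟩
        · exact h2 b hb
    · exact ⟨[], by rw [runOn_cons_notMem ha]; rfl, by simp⟩

theorem runOn_fst_mem {N : Set X} (hN : ∀ e ∈ D, act e.2 e.1 ∈ N) (hz : z ∈ N) :
    (runOn act D z σ).1 ∈ N := by
  induction σ generalizing z with
  | nil => exact hz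
  | cons a σ ih =>
    by_cases ha : (z, a) ∈ D
    · rw [runOn_cons_mem ha]; exact ih (hN _ ha)
    · rw [runOn_cons_notMem ha]; exact hz

theorem exists_finite_nodes (hD : D.Finite) (w : X) :
    ∃ N : Set X, N.Finite ∧ ∀ σ, (runOn act D w σ).1 ∈ N :=
  ⟨insert w ((fun e => act e.2 e.1) '' D), (hD.image _).insert _, fun _ =>
    runOn_fst_mem (fun e he => Or.inr ⟨e, he, rfl⟩) (Or.inl rfl)⟩

theorem exists_eq_iUnion_of_finite {α : Type*} {s : ℕ → Set α} (hs : Monotone s)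
    (h : (⋃ i, s i).Finite) : ∃ i, s i = ⋃ i, s i := by
  choose! f hf using fun a (ha : a ∈ ⋃ i, s i) => Set.mem_iUnion.1 ha
  obtain ⟨M, hM⟩ := (h.image f).bddAbove
  exact ⟨M, (Set.subset_iUnion s M).antisymm fun a ha => hs (hM ⟨a, ha, rfl⟩) (hf a ha)⟩

theorem exists_finite_exceptions (lvl : ℕ → ℕ) (p : ℕ → List ℕ × ℕ) (w : X)
    (G : Set (X × ℕ)) (J : Set ℕ) (Y : X → Prop) (hGJ : ∀ e ∈ G, e.2 ∈ J)
    (hA : ∀ D ⊆ G, D.Finite → ∀ z b, (z, b) ∉ G → {θ : List ℕ × ℕ | ∃ n,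
      runOn act D w (p n).1 = (z, b :: θ.1) ∧ (p n).2 = θ.2}.Finite)
    (hB : ∀ D ⊆ G, D.Finite → ∀ z, {b | ∃ n τ, runOn act D w (p n).1 = (z, b :: τ)}.Finite)
    (hE : ∀ D ⊆ G, D.Finite → ∀ z, {h | ∃ n, runOn act D w (p n).1 = (z, []) ∧ (p n).2 = h ∧
      ¬ (Y z ∧ h = n)}.Finite)
    (hW : (highSteps lvl p).Infinite → ¬ highSteps lvl p ⊆ J)
    (hfin : ∀ P, (⋃ i, stepClosure act lvl p P w i) ⊆ G →
      (⋃ i, stepClosure act lvl p P w i).Finite) :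
    ∃ D ⊆ G, D.Finite ∧ {ξ : X × List ℕ × ℕ | ∃ n, runOn act D w (p n).1 = (ξ.1, ξ.2.1) ∧
      (p n).2 = ξ.2.2 ∧ ¬ (Y ξ.1 ∧ ξ.2.1 = [] ∧ ξ.2.2 = n)}.Finite := by
  have hclo : ∀ P i, stepClosure act lvl p P w i ⊆ G ∧ (stepClosure act lvl p P w i).Finite := by
    intro P i
    induction i with
    | zero => exact ⟨Set.empty_subset _, Set.finite_empty⟩
    | succ i ih =>
      obtain ⟨N, hN, hNm⟩ := exists_finite_nodes (act := act) ih.2 w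
      rw [stepClosure]
      refine ⟨Set.union_subset ih.1 ?_, ih.2.union ?_⟩
      · rintro ⟨z, b⟩ ⟨-, hinf⟩
        by_contra hzb
        exact hinf (hA _ ih.1 ih.2 z b hzb)
      · refine (hN.biUnion fun z _ => (Set.finite_singleton z).prod (hB _ ih.1 ih.2 z)).subset ?_
        rintro ⟨z, b⟩ ⟨-, hinf⟩
        obtain ⟨θ, n, hn, -⟩ := hinf.nonempty
        refine Set.mem_biUnion (x := z) ?_ ⟨rfl, n, θ.1, hn⟩
        have := hNm (p n).1
        rwa [hn] at this
  have hmono : ∀ P, Monotone (stepClosure act lvl p P w) := fun P =>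
    monotone_nat_of_le_succ fun i => by rw [stepClosure]; exact Set.subset_union_left
  have hstage : ∀ P, ∃ D ⊆ G, D.Finite ∧ (∀ e ∈ D, lvl e.2 ≤ P) ∧
      ∀ z b, lvl b ≤ P → {θ : List ℕ × ℕ | ∃ n,
        runOn act D w (p n).1 = (z, b :: θ.1) ∧ (p n).2 = θ.2}.Finite := by
    intro P
    obtain ⟨i, hi⟩ := exists_eq_iUnion_of_finite (hmono P)
      (hfin P (Set.iUnion_subset fun i => (hclo P i).1))
    refine ⟨_, (hclo P i).1, (hclo P i).2, ?_, fun z b hb => ?_⟩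
    · clear hi
      induction i with
      | zero => intro e he; exact absurd he (Set.notMem_empty _)
      | succ i ih =>
        rw [stepClosure]
        rintro e (he | he)
        · exact ih e he
        · exact he.1
    · by_contra hinf
      have hmem : (z, b) ∈ stepClosure act lvl p P w (i + 1) := by
        rw [stepClosure]; exact Or.inr ⟨hb, hinf⟩
      have hmem' : (z, b) ∈ stepClosure act lvl p P w i := by
        rw [hi]; exact Set.mem_iUnion.2 ⟨_, hmem⟩
      obtain ⟨θ, n, hn, -⟩ := (show Set.Infinite _ from hinf).nonempty
      exact notMem_of_runOn_eq_cons hn hmem'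
  choose D hDG hDfin hDlvl hDlow using hstage
  have hlow : ∀ P, {ξ : X × List ℕ × ℕ | ∃ n b τ, runOn act (D P) w (p n).1 = (ξ.1, b :: τ) ∧
      ξ.2.1 = b :: τ ∧ (p n).2 = ξ.2.2 ∧ lvl b ≤ P}.Finite := by
    intro P
    obtain ⟨N, hN, hNm⟩ := exists_finite_nodes (act := act) (hDfin P) w
    refine (hN.biUnion fun z _ => (hB _ (hDG P) (hDfin P) z).biUnion fun b _ =>
      Set.Finite.image (fun θ : List ℕ × ℕ => (z, b :: θ.1, θ.2))
        (s := {θ | lvl b ≤ P ∧ θ ∈ {θ : List ℕ × ℕ | ∃ n,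
        runOn act (D P) w (p n).1 = (z, b :: θ.1) ∧ (p n).2 = θ.2}}) ?_).subset ?_
    · by_cases hb : lvl b ≤ P
      · exact (hDlow P z b hb).subset fun θ hθ => hθ.2
      · exact Set.finite_empty.subset fun θ hθ => absurd hθ.1 hb
    · rintro ⟨z, τ', h⟩ ⟨n, b, τ, hn, h1, h2, hb⟩
      have hz := hNm (p n).1
      rw [hn] at hz
      refine Set.mem_biUnion (x := z) hz (Set.mem_biUnion (x := b) ⟨n, τ, hn⟩ ?_)
      simp only at h1 h2
      subst h1
      exact ⟨(τ, h), ⟨hb, n, hn, h2⟩, rfl⟩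
  by_cases hΘ : ∃ P, (highTails lvl p P).Finite
  · obtain ⟨P, hP⟩ := hΘ
    obtain ⟨N, hN, hNm⟩ := exists_finite_nodes (act := act) (hDfin P) w
    refine ⟨D P, hDG P, hDfin P, ?_⟩
    refine ((hlow P).union ((hN.prod (hP.image fun θ => (θ.1 :: θ.2.1, θ.2.2))).union
      (hN.biUnion fun z _ => (hE _ (hDG P) (hDfin P) z).image fun h => (z, ([] : List ℕ), h)))).subset ?_
    rintro ⟨z, τ, h⟩ ⟨n, hn, hh, hY⟩
    have hz := hNm (p n).1
    rw [hn] at hz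
    cases τ with
    | nil =>
      refine Or.inr (Or.inr (Set.mem_biUnion (x := z) hz ⟨h, ⟨n, hn, hh, ?_⟩, rfl⟩))
      simpa using hY
    | cons b τ =>
      by_cases hb : lvl b ≤ P
      · exact Or.inl ⟨n, b, τ, hn, rfl, hh, hb⟩
      · refine Or.inr (Or.inl ⟨hz, (b, τ, h), ?_, rfl⟩)
        obtain ⟨π, h1, h2⟩ := exists_eq_append_runOn (act := act) (D := D P) w (p n).1
        rw [hn] at h1
        refine ⟨n, π, h1, hh, fun a ha => ?_, not_le.1 hb⟩
        obtain ⟨y, hy⟩ := h2 a ha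
        exact hDlvl P _ hy
  · exfalso
    have hΘinf : ∀ P, (highTails lvl p P).Infinite := fun P hP => hΘ ⟨P, hP⟩
    have hcover : ∀ P, ∃ S : Set (ℕ × List ℕ × ℕ), S.Finite ∧ ∀ θ ∈ highTails lvl p P, θ ∈ S ∨
        ∃ n z, runOn act (D P) w (p n).1 = (z, θ.1 :: θ.2.1) ∧ (p n).2 = θ.2.2 := by
      intro P
      refine ⟨⋃ ξ ∈ {ξ : X × List ℕ × ℕ | ∃ n b τ, runOn act (D P) w (p n).1 = (ξ.1, b :: τ) ∧
        ξ.2.1 = b :: τ ∧ (p n).2 = ξ.2.2 ∧ lvl b ≤ P}, {θ | θ.1 :: θ.2.1 ∈ ξ.2.1.tails ∧ θ.2.2 = ξ.2.2},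
        (hlow P).biUnion fun ξ _ => ?_, ?_⟩
      · refine Set.Finite.of_injOn (f := fun θ : ℕ × List ℕ × ℕ => (θ.1 :: θ.2.1, θ.2.2))
          (t := {τ | τ ∈ ξ.2.1.tails} ×ˢ {ξ.2.2}) (fun θ hθ => ⟨hθ.1, hθ.2⟩) ?_
          ((List.finite_toSet _).prod (Set.finite_singleton _))
        rintro ⟨a, b, c⟩ - ⟨a', b', c'⟩ - h
        simpa [and_assoc] using h
      · rintro ⟨b, τ, h⟩ ⟨n, π, h1, h2, h3, h4⟩
        obtain ⟨π', h5, h6⟩ := exists_eq_append_runOn (act := act) (D := D P) w (p n).1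
        have h7 : ∀ a ∈ π', lvl a ≤ P := fun a ha => by
          obtain ⟨y, hy⟩ := h6 a ha
          exact hDlvl P _ hy
        have hsplit : ∀ R, (p n).1 = π' ++ R → ∃ π'', R = π'' ++ b :: τ ∧ ∀ a ∈ π'', lvl a ≤ P := by
          intro R hR
          rw [h1] at hR
          rcases List.append_eq_append_iff.1 hR with ⟨a', ha1, ha2⟩ | ⟨c', hc1, hc2⟩
          · cases a' with
            | nil => exact ⟨[], by simpa using ha2.symm, by simp⟩
            | cons a a' =>
              simp only [List.cons_append, List.cons.injEq] at ha2
              have := h7 a (by rw [ha1]; simp)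
              rw [← ha2.1] at this
              simp only at h4
              omega
          · exact ⟨c', hc2, fun a ha => h3 a (by rw [hc1]; simp [ha])⟩
        obtain ⟨π'', h8⟩ := hsplit _ h5
        cases π'' with
        | nil =>
          refine Or.inr ⟨n, (runOn act (D P) w (p n).1).1, ?_, h2⟩
          rw [Prod.ext_iff]
          exact ⟨rfl, by simpa using h8.1⟩
        | cons a π'' =>
          refine Or.inl (Set.mem_biUnion (x := ((runOn act (D P) w (p n).1).1,
            a :: (π'' ++ b :: τ), h)) ?_ ?_)
          · refine ⟨n, a, π'' ++ b :: τ, ?_, rfl, h2, h8.2 a (by simp)⟩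
            rw [Prod.ext_iff]
            exact ⟨rfl, by simpa using h8.1⟩
          · refine ⟨?_, rfl⟩
            rw [List.mem_tails]
            exact ⟨a :: π'', by simp⟩
    have hWJ : highSteps lvl p ⊆ J := by
      rintro b ⟨P, -, hinf⟩
      obtain ⟨N, hN, hNm⟩ := exists_finite_nodes (act := act) (hDfin P) w
      obtain ⟨S, hS, hcov⟩ := hcover P
      by_contra hb
      refine hinf (((hS.image Prod.snd).union (hN.biUnion fun z _ =>
        hA (D P) (hDG P) (hDfin P) z b fun hzb => hb (hGJ _ hzb))).subset ?_)
      intro θ hθ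
      rcases hcov _ hθ with h | ⟨n, z, hn, hh⟩
      · exact Or.inl ⟨_, h, rfl⟩
      · have hz := hNm (p n).1
        rw [hn] at hz
        exact Or.inr (Set.mem_biUnion (x := z) hz ⟨n, hn, hh⟩)
    refine hW ?_ hWJ
    have hex : ∀ P, ∃ b ∈ highSteps lvl p, P < lvl b := by
      intro P
      by_contra hno
      push Not at hno
      obtain ⟨N, hN, hNm⟩ := exists_finite_nodes (act := act) (hDfin P) w
      obtain ⟨S, hS, hcov⟩ := hcover P
      have hfinb : ∀ b, {θ : List ℕ × ℕ | (b, θ) ∈ highTails lvl p P}.Finite := by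
        intro b
        by_contra hinf
        obtain ⟨θ, hθ⟩ := (show Set.Infinite _ from hinf).nonempty
        have hb : P < lvl b := hθ.choose_spec.choose_spec.2.2.2
        exact absurd (hno b ⟨P, hb, hinf⟩) (not_le.2 hb)
      refine hΘinf P ((hS.union (hN.biUnion fun z _ =>
        (hB (D P) (hDG P) (hDfin P) z).biUnion fun b _ => (hfinb b).image (Prod.mk b))).subset ?_)
      rintro ⟨b, θ⟩ hθ
      rcases hcov _ hθ with h | ⟨n, z, hn, hh⟩
      · exact Or.inl h
      · have hz := hNm (p n).1
        rw [hn] at hz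
        exact Or.inr (Set.mem_biUnion (x := z) hz (Set.mem_biUnion (x := b) ⟨n, _, hn⟩ ⟨θ, hθ, rfl⟩))
    intro hf
    obtain ⟨M, hM⟩ := (hf.image lvl).bddAbove
    obtain ⟨b, hb, hlt⟩ := hex M
    exact absurd (hM ⟨b, hb, rfl⟩) (not_le.2 hlt)

end Runs

section Coloring

variable {X : Type*} [MeasurableSpace X]

theorem exists_measurable_next {blk : ℕ → ℕ} (hblk : ∀ s, {m | blk m ≤ s}.Finite)
    {B : X → ℕ → Prop} (hB : ∀ m, MeasurableSet {x | B x m}) {k : X → ℕ} (hk : Measurable k) :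
    ∃ a : X → ℕ, Measurable a ∧ (∀ x, k x < blk (a x)) ∧
      ∀ x, {m | B x m}.Infinite → B x (a x) := by
  have hbig : ∀ (S : Set ℕ), S.Infinite → ∀ s, ∃ m ∈ S, s < blk m := by
    intro S hS s
    obtain ⟨m, hm, hm'⟩ := (hS.sdiff (hblk s)).nonempty
    exact ⟨m, hm, not_le.1 hm'⟩
  have hex : ∀ x, ∃ m, k x < blk m ∧ (B x m ∨ ∀ m', B x m' → blk m' ≤ k x) := by
    intro x
    by_cases h : ∃ m, B x m ∧ k x < blk m
    · obtain ⟨m, h1, h2⟩ := h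
      exact ⟨m, h2, Or.inl h1⟩
    · push Not at h
      obtain ⟨m, -, hm⟩ := hbig Set.univ Set.infinite_univ (k x)
      exact ⟨m, hm, Or.inr h⟩
  have hkm : ∀ m, MeasurableSet {x | k x < blk m} := fun m => hk measurableSet_Iio
  refine ⟨fun x => Nat.find (hex x), measurable_find hex fun m => ?_,
    fun x => (Nat.find_spec (hex x)).1, fun x hx => ?_⟩
  · refine measurableSet_and (hkm m) ?_
    refine (hB m).union (measurableSet_forall fun m' => ?_)
    simp only [imp_iff_not_or]
    exact (hB m').compl.union (hk measurableSet_Ici)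
  · rcases (Nat.find_spec (hex x)).2 with h | h
    · exact h
    · obtain ⟨m, h1, h2⟩ := hbig _ hx (k x)
      exact absurd (h m h1) (not_le.2 h2)

/-- A Borel choice of a set of naturals with at most one element in each block, that splits
every infinite set in a given countable Borel list. -/
theorem exists_measurable_splitting {blk : ℕ → ℕ} (hblk : ∀ s, {m | blk m ≤ s}.Finite)
    {B : ℕ → X → ℕ → Prop} (hB : ∀ r m, MeasurableSet {x | B r x m}) :
    ∃ g : X → ℕ → Bool, Measurable g ∧
      (∀ x m m', g x m = true → g x m' = true → blk m = blk m' → m = m') ∧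
      ∀ r x, {m | B r x m}.Infinite → ∀ γ, ∃ m, B r x m ∧ g x m = γ := by
  have hstep : ∀ (r : ℕ) (k : {k : X → ℕ // Measurable k}), ∃ ab : (X → ℕ) × {b : X → ℕ // Measurable b},
      Measurable ab.1 ∧ (∀ x, k.1 x < blk (ab.1 x)) ∧ (∀ x, blk (ab.1 x) < blk (ab.2.1 x)) ∧
      ∀ x, {m | B r x m}.Infinite → B r x (ab.1 x) ∧ B r x (ab.2.1 x) := by
    rintro r ⟨k, hk⟩
    obtain ⟨a, ha, ha1, ha2⟩ := exists_measurable_next hblk (hB r) hk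
    have hba : Measurable fun x => blk (a x) := (measurable_from_top (f := blk)).comp ha
    obtain ⟨b, hb, hb1, hb2⟩ := exists_measurable_next hblk (hB r) hba
    exact ⟨(a, ⟨b, hb⟩), ha, ha1, hb1, fun x hx => ⟨ha2 x hx, hb2 x hx⟩⟩
  choose ab h1 h2 h3 h4 using hstep
  let k : ℕ → {k : X → ℕ // Measurable k} := fun r => Nat.rec ⟨fun _ => 0, measurable_const⟩
    (fun r k => ⟨fun x => blk ((ab r k).2.1 x), (measurable_from_top (f := blk)).comp (ab r k).2.2⟩) r
  have hk : ∀ r x, (k (r + 1)).1 x = blk ((ab r (k r)).2.1 x) := fun r x => rfl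
  let a : ℕ → X → ℕ := fun r => (ab r (k r)).1
  let b : ℕ → X → ℕ := fun r => (ab r (k r)).2.1
  have hab : ∀ r x, blk (a r x) < blk (b r x) := fun r x => h3 _ _ x
  have hba : ∀ r x, blk (b r x) < blk (a (r + 1) x) := fun r x => by
    have := h2 (r + 1) (k (r + 1)) x
    rwa [hk] at this
  have hmono : ∀ x, StrictMono fun r => blk (a r x) := fun x =>
    strictMono_nat_of_lt_succ fun r => (hab r x).trans (hba r x)
  refine ⟨fun x m => decide (∃ r, a r x = m), ?_, ?_, ?_⟩
  · refine measurable_pi_lambda _ fun m => ?_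
    have : (fun x => decide (∃ r, a r x = m)) = fun x => if ∃ r, a r x = m then true else false := by
      funext x; by_cases hx : ∃ r, a r x = m <;> simp [hx]
    rw [this]
    exact Measurable.ite (measurableSet_exists fun r =>
      measurableSet_eq_fun (h1 r (k r)) measurable_const) measurable_const measurable_const
  · intro x m m' hm hm' he
    obtain ⟨r, rfl⟩ := of_decide_eq_true hm
    obtain ⟨r', rfl⟩ := of_decide_eq_true hm'
    rw [(hmono x).injective he]
  · intro r x hx γ
    obtain ⟨ha, hb⟩ := h4 r (k r) x hx
    cases γ
    · refine ⟨b r x, hb, decide_eq_false ?_⟩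
      rintro ⟨r', hr'⟩
      have e : blk (a r' x) = blk (b r x) := by rw [hr']
      have l1 : blk (a r x) < blk (a r' x) := e ▸ hab r x
      have l2 : blk (a r' x) < blk (a (r + 1) x) := e ▸ hba r x
      have l1' := (hmono x).lt_iff_lt.1 l1
      have l2' := (hmono x).lt_iff_lt.1 l2
      omega
    · exact ⟨a r x, ha, decide_eq_true ⟨r, rfl⟩⟩

theorem exists_blocks {e : ℕ → ℕ} (he : Function.Injective e) {ι : Type*} [Countable ι]
    (K : ι → Set ℕ) (h : ι → ℕ → ℕ) :
    ∃ blk : ℕ → ℕ, (∀ s, {m | blk m ≤ s}.Finite) ∧ ∀ i, (h i '' K i).Infinite →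
      ∃ r, ∀ s ≥ r, ∃ S : Finset ℕ, S.card = 3 ∧ Set.InjOn (h i) S ∧
        ∀ n ∈ S, n ∈ K i ∧ blk (e n) = s ∧ blk (h i n) = s := by
  have hthree : ∀ i, (h i '' K i).Infinite → ∀ M, ∃ M' > M, ∃ S : Finset ℕ, S.card = 3 ∧
      Set.InjOn (h i) S ∧ ∀ n ∈ S, n ∈ K i ∧ M ≤ e n ∧ e n < M' ∧ M ≤ h i n ∧ h i n < M' := by
    intro i hi M
    obtain ⟨K', hK', hinj⟩ := (Set.surjOn_image (h i) (K i)).exists_bijOn_subset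
    have hK'inf : K'.Infinite := fun hf => hi (by rw [← hinj.image_eq]; exact hf.image _)
    have hsmall : ({n | e n < M} ∪ {n ∈ K' | h i n < M}).Finite := by
      refine Set.Finite.union ?_ ?_
      · exact (Set.finite_Iio M).preimage he.injOn
      · exact Set.Finite.of_injOn (f := h i) (t := Set.Iio M) (fun n hn => hn.2)
          (hinj.injOn.mono fun n hn => hn.1) (Set.finite_Iio M)
    obtain ⟨S, hS, hcard⟩ := (hK'inf.sdiff hsmall).exists_subset_card_eq 3
    obtain ⟨M', hM'⟩ := ((S.image e ∪ S.image (h i)) : Finset ℕ).bddAbove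
    refine ⟨max M M' + 1, by omega, S, hcard, hinj.injOn.mono fun n hn => (hS hn).1,
      fun n hn => ?_⟩
    have h1 := hS hn
    have h2 : e n ≤ M' := hM' (by simp only [Finset.coe_union, Finset.coe_image]; exact Or.inl ⟨n, hn, rfl⟩)
    have h3 : h i n ≤ M' := hM' (by simp only [Finset.coe_union, Finset.coe_image]; exact Or.inr ⟨n, hn, rfl⟩)
    have h4 : ¬ e n < M := fun hlt => h1.2 (Or.inl hlt)
    have h5 : ¬ h i n < M := fun hlt => h1.2 (Or.inr ⟨h1.1, hlt⟩)
    exact ⟨hK' h1.1, by omega, by omega, by omega, by omega⟩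
  obtain ⟨c, hc⟩ := Countable.exists_injective_nat ι
  have hnext : ∀ s M, ∃ M' > M, ∀ i, c i ≤ s → (h i '' K i).Infinite → ∃ S : Finset ℕ,
      S.card = 3 ∧ Set.InjOn (h i) S ∧
        ∀ n ∈ S, n ∈ K i ∧ M ≤ e n ∧ e n < M' ∧ M ≤ h i n ∧ h i n < M' := by
    intro s M
    have hex : ∀ i, ∃ M' > M, (h i '' K i).Infinite → ∃ S : Finset ℕ, S.card = 3 ∧
        Set.InjOn (h i) S ∧ ∀ n ∈ S, n ∈ K i ∧ M ≤ e n ∧ e n < M' ∧ M ≤ h i n ∧ h i n < M' := by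
      intro i
      by_cases hi : (h i '' K i).Infinite
      · obtain ⟨M', h1, h2⟩ := hthree i hi M
        exact ⟨M', h1, fun _ => h2⟩
      · exact ⟨M + 1, Nat.lt_succ_self M, fun hi' => absurd hi' hi⟩
    choose Mf hM1 hM2 using hex
    have hfin : {i | c i ≤ s}.Finite := (Set.finite_Iic s).preimage hc.injOn
    obtain ⟨L, hL⟩ := (hfin.image Mf).bddAbove
    refine ⟨max L (M + 1), by omega, fun i hi hinf => ?_⟩
    obtain ⟨S, hS1, hS2, hS3⟩ := hM2 i hinf
    have : Mf i ≤ L := hL ⟨i, hi, rfl⟩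
    refine ⟨S, hS1, hS2, fun n hn => ?_⟩
    obtain ⟨g1, g2, g3, g4, g5⟩ := hS3 n hn
    exact ⟨g1, g2, by omega, g4, by omega⟩
  choose nx hnx1 hnx2 using hnext
  let L : ℕ → ℕ := fun s => Nat.rec 0 (fun s M => nx s M) s
  have hL : ∀ s, L (s + 1) = nx s (L s) := fun s => rfl
  have hLm : StrictMono L := strictMono_nat_of_lt_succ fun s => hnx1 s (L s)
  have hblk : ∀ m, ∃ s, L s ≤ m ∧ m < L (s + 1) := by
    intro m
    have hex : ∃ s, m < L (s + 1) := ⟨m, (Nat.lt_succ_self m).trans_le (hLm.id_le _)⟩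
    refine ⟨Nat.find hex, ?_, Nat.find_spec hex⟩
    rcases hs : Nat.find hex with _ | s
    · exact Nat.zero_le _
    · exact not_lt.1 (Nat.find_min hex (by omega))
  choose blk hb1 hb2 using hblk
  have hblk_eq : ∀ s m, L s ≤ m → m < L (s + 1) → blk m = s := by
    intro s m h1 h2
    have h3 : blk m < s + 1 := hLm.lt_iff_lt.1 ((hb1 m).trans_lt h2)
    have h4 : s < blk m + 1 := hLm.lt_iff_lt.1 (h1.trans_lt (hb2 m))
    omega
  refine ⟨blk, fun s => (Set.finite_Iio (L (s + 1))).subset fun m hm => ?_, fun i hi => ⟨c i, fun s hs => ?_⟩⟩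
  · exact (hb2 m).trans_le (hLm.monotone (Nat.succ_le_succ hm))
  · obtain ⟨S, hS1, hS2, hS3⟩ := hnx2 s (L s) i hs hi
    refine ⟨S, hS1, hS2, fun n hn => ?_⟩
    obtain ⟨g1, g2, g3, g4, g5⟩ := hS3 n hn
    exact ⟨g1, hblk_eq s _ g2 g3, hblk_eq s _ g4 g5⟩

theorem exists_coloring {φ : ℕ → (ℕ → Bool) → ℕ → Bool} (hφ : ∀ j, Measurable (φ j))
    {e : ℕ → ℕ} (he : Function.Injective e) {ι : Type*} [Countable ι]
    (K : ι → Set ℕ) (h k : ι → ℕ → ℕ) :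
    ∃ c : (ℕ → Bool) → ℕ → Bool, Measurable c ∧ ∀ i,
      ((h i '' K i).Infinite → ∀ z j γ, ∃ n ∈ K i, xor (c z (h i n)) (φ j z (k i n)) = γ) ∧
      ((h i '' K i).Infinite → ∀ y z, y ≠ z → ∃ n ∈ K i, c y (e n) ≠ c z (h i n)) ∧
      ((h i '' K i).Infinite → ∀ z, (∀ n ∈ K i, h i n ≠ e n) →
        ∃ n ∈ K i, c z (e n) ≠ c z (h i n)) ∧
      ((K i).Infinite → ∀ z γ, ∃ n ∈ K i, c z (e n) = γ) := by
  obtain ⟨blk, hblk, hthree⟩ := exists_blocks he K h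
  let T : (ℕ → Bool) → ℕ → Bool := fun z m => z (Nat.unpair (blk m)).1
  have hT : ∀ m, Measurable fun z => T z m := fun m => measurable_pi_apply _
  let B : (ι × ℕ × Bool) ⊕ (ι × Bool) ⊕ ι → (ℕ → Bool) → ℕ → Prop
    | .inl (i, j, γ) => fun z m => ∃ n, (n ∈ K i ∧ h i n = m) ∧ φ j z (k i n) = xor γ (T z m)
    | .inr (.inl (i, γ)) => fun z m => ∃ n, (n ∈ K i ∧ e n = m) ∧ T z m = γ
    | .inr (.inr i) => fun _ m => ∃ n ∈ K i, e n = m ∧ blk (e n) = blk (h i n) ∧ e n ≠ h i n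
  have hBm : ∀ q m, MeasurableSet {z | B q z m} := by
    rintro (⟨i, j, γ⟩ | ⟨i, γ⟩ | i) m
    · refine measurableSet_exists fun n => measurableSet_and (MeasurableSet.const _)
        (measurableSet_eq_fun ((measurable_pi_apply _).comp (hφ j)) ?_)
      exact (measurable_from_top (f := fun t => xor γ t)).comp (hT m)
    · exact measurableSet_exists fun n => measurableSet_and (MeasurableSet.const _)
        (measurableSet_eq_fun (hT m) measurable_const)
    · exact MeasurableSet.const _
  obtain ⟨enc, henc⟩ := Countable.exists_injective_nat ((ι × ℕ × Bool) ⊕ (ι × Bool) ⊕ ι)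
  obtain ⟨g, hgm, hg1, hg2⟩ := exists_measurable_splitting hblk
    (B := fun r z m => ∃ q, enc q = r ∧ B q z m) fun r m =>
      measurableSet_exists fun q => measurableSet_and (MeasurableSet.const _) (hBm q m)
  have hg3 : ∀ q z, {m | B q z m}.Infinite → ∀ γ, ∃ m, B q z m ∧ g z m = γ := by
    intro q z hq γ
    obtain ⟨m, ⟨q', h1, h2⟩, h3⟩ := hg2 (enc q) z (hq.mono fun m hm => ⟨q, rfl, hm⟩) γ
    rw [henc h1] at h2
    exact ⟨m, h2, h3⟩
  refine ⟨fun z m => xor (T z m) (g z m), measurable_pi_lambda _ fun m => ?_, fun i =>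
    ⟨fun hi z j γ => ?_, fun hi y z hyz => ?_, fun hi z hne => ?_, fun hi z γ => ?_⟩⟩
  · exact (measurable_of_countable fun t : Bool × Bool => xor t.1 t.2).comp
      ((hT m).prodMk ((measurable_pi_apply m).comp hgm))
  · have hor : ∃ γ, {m | B (.inl (i, j, γ)) z m}.Infinite := by
      by_contra hno
      push Not at hno
      refine hi (((hno true).union (hno false)).subset ?_)
      rintro _ ⟨n, hn, rfl⟩
      cases hb : xor (φ j z (k i n)) (T z (h i n))
      · refine Or.inr ⟨n, ⟨hn, rfl⟩, ?_⟩
        revert hb; cases φ j z (k i n) <;> cases T z (h i n) <;> simp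
      · refine Or.inl ⟨n, ⟨hn, rfl⟩, ?_⟩
        revert hb; cases φ j z (k i n) <;> cases T z (h i n) <;> simp
    obtain ⟨γ', hγ'⟩ := hor
    obtain ⟨m, ⟨n, ⟨hn, rfl⟩, hn2⟩, hm⟩ := hg3 (.inl (i, j, γ')) z hγ' (xor γ γ')
    refine ⟨n, hn, ?_⟩
    simp only [hn2, hm]
    cases T z (h i n) <;> cases γ <;> cases γ' <;> rfl
  · obtain ⟨a, ha⟩ := Function.ne_iff.1 hyz
    obtain ⟨r, hr⟩ := hthree i hi
    obtain ⟨S, hS1, hS2, hS3⟩ := hr (Nat.pair a r) (Nat.right_le_pair a r)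
    have c1 : (S.filter fun n => g y (e n) = true).card ≤ 1 := by
      refine Finset.card_le_one.2 fun n hn n' hn' => he ?_
      simp only [Finset.mem_filter] at hn hn'
      exact hg1 y _ _ hn.2 hn'.2 (by rw [(hS3 n hn.1).2.1, (hS3 n' hn'.1).2.1])
    have c2 : (S.filter fun n => g z (h i n) = true).card ≤ 1 := by
      refine Finset.card_le_one.2 fun n hn n' hn' => ?_
      simp only [Finset.mem_filter] at hn hn'
      exact hS2 hn.1 hn'.1
        (hg1 z _ _ hn.2 hn'.2 (by rw [(hS3 n hn.1).2.2, (hS3 n' hn'.1).2.2]))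
    obtain ⟨n, hn, hn'⟩ : ∃ n ∈ S, n ∉ (S.filter fun n => g y (e n) = true) ∪
        (S.filter fun n => g z (h i n) = true) := by
      refine Finset.exists_mem_notMem_of_card_lt_card ?_
      refine (Finset.card_union_le _ _).trans_lt ?_
      omega
    simp only [Finset.mem_union, Finset.mem_filter, not_or, hn, true_and, Bool.not_eq_true] at hn'
    refine ⟨n, (hS3 n hn).1, ?_⟩
    simp only [hn'.1, hn'.2, Bool.xor_false, T, (hS3 n hn).2.1, (hS3 n hn).2.2, Nat.unpair_pair]
    exact ha
  · have hinf : {m | B (.inr (.inr i)) z m}.Infinite := by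
      obtain ⟨r, hr⟩ := hthree i hi
      have hpick : ∀ t, ∃ m ∈ {m | B (.inr (.inr i)) z m}, blk m = r + t := by
        intro t
        obtain ⟨S, hS1, hS2, hS3⟩ := hr (r + t) (Nat.le_add_right r t)
        obtain ⟨n, hn⟩ := Finset.card_pos.1 (by omega : 0 < S.card)
        obtain ⟨g1, g2, g3⟩ := hS3 n hn
        exact ⟨e n, ⟨n, g1, rfl, g2.trans g3.symm, (hne n g1).symm⟩, g2⟩
      choose f hf1 hf2 using hpick
      refine Set.infinite_of_injective_forall_mem (f := f) (fun t t' htt => ?_) hf1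
      have := hf2 t
      rw [htt, hf2 t'] at this
      omega
    obtain ⟨m, ⟨n, hn, rfl, hn1, hn2⟩, hm⟩ := hg3 (.inr (.inr i)) z hinf true
    refine ⟨n, hn, ?_⟩
    have hgf : g z (h i n) = false := by
      rw [← Bool.not_eq_true]
      exact fun ht => hn2 (hg1 z _ _ hm ht hn1)
    simp only [hm, hgf, T, hn1]
    cases z (Nat.unpair (blk (h i n))).1 <;> simp
  · have hor : ∃ γ, {m | B (.inr (.inl (i, γ))) z m}.Infinite := by
      by_contra hno
      push Not at hno
      refine hi.image he.injOn (((hno true).union (hno false)).subset ?_)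
      rintro _ ⟨n, hn, rfl⟩
      cases hb : T z (e n)
      · exact Or.inr ⟨n, ⟨hn, rfl⟩, hb⟩
      · exact Or.inl ⟨n, ⟨hn, rfl⟩, hb⟩
    obtain ⟨γ', hγ'⟩ := hor
    obtain ⟨m, ⟨n, ⟨hn, rfl⟩, hn2⟩, hm⟩ := hg3 (.inr (.inl (i, γ'))) z hγ' (xor γ γ')
    refine ⟨n, hn, ?_⟩
    simp only [hn2, hm]
    cases γ <;> cases γ' <;> rfl

end Coloring

/-- A set with one element in each column `{Nat.pair m t | t}` such that no infinite set in a
given countable family is almost contained in it. -/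
theorem exists_column_section {ι : Type*} [Countable ι] (A : ι → Set ℕ) :
    ∃ s : ℕ → ℕ, ∀ i, (A i).Infinite →
      (A i \ {b | (Nat.unpair b).2 = s (Nat.unpair b).1}).Infinite := by
  obtain ⟨c, hc⟩ := Countable.exists_injective_nat ι
  have hfin : ∀ m, {i | c i ≤ m}.Finite := fun m => (Set.finite_Iic m).preimage hc.injOn
  have hs : ∀ m, ∃ L, ∀ i, c i ≤ m → sInf {t | Nat.pair m t ∈ A i} < L := by
    intro m
    obtain ⟨L, hL⟩ := ((hfin m).image fun i => sInf {t | Nat.pair m t ∈ A i}).bddAbove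
    exact ⟨L + 1, fun i hi => Nat.lt_succ_of_le (hL ⟨i, hi, rfl⟩)⟩
  choose s hs using hs
  refine ⟨s, fun i hi hf => ?_⟩
  set J : Set ℕ := {b | (Nat.unpair b).2 = s (Nat.unpair b).1} with hJ
  have hinf : (A i ∩ J).Infinite := fun h => hi ((h.union hf).subset fun b hb => by
    by_cases hbJ : b ∈ J
    · exact Or.inl ⟨hb, hbJ⟩
    · exact Or.inr ⟨hb, hbJ⟩)
  have hinj : Set.InjOn (fun b => (Nat.unpair b).1) J := by
    intro b hb b' hb' h
    have h1 : (Nat.unpair b).2 = s (Nat.unpair b).1 := hb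
    have h2 : (Nat.unpair b').2 = s (Nat.unpair b').1 := hb'
    simp only at h
    rw [← Nat.pair_unpair b, ← Nat.pair_unpair b', h1, h2, h]
  have hinf' : ((fun b => (Nat.unpair b).1) '' (A i ∩ J)).Infinite :=
    hinf.image (hinj.mono Set.inter_subset_right)
  refine (hinf'.sdiff (Set.finite_Iio (c i))) ((hf.image fun b => (Nat.unpair b).1).subset ?_)
  rintro _ ⟨⟨b, ⟨hbA, hbJ⟩, rfl⟩, hm⟩
  set m := (Nat.unpair b).1 with hmdef
  have hne : {t | Nat.pair m t ∈ A i}.Nonempty :=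
    ⟨(Nat.unpair b).2, by
      show Nat.pair m (Nat.unpair b).2 ∈ A i
      rwa [hmdef, Nat.pair_unpair]⟩
  have hlt := hs m i (not_lt.1 hm)
  refine ⟨Nat.pair m (sInf {t | Nat.pair m t ∈ A i}), ⟨Nat.sInf_mem hne, fun h => ?_⟩, ?_⟩
  · simp only [hJ, Set.mem_ofPred_eq, Nat.unpair_pair] at h
    omega
  · simp [hmdef]

/-- The analogue of `runOn` on the states of a finite partial transition table. -/
def runTable (t : List (Option ℕ)) : ℕ → List ℕ → ℕ × List ℕ
  | q, [] => (q, [])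
  | q, b :: τ => match t.getD (Nat.pair q b) none with
    | none => (q, b :: τ)
    | some q' => runTable t q' τ

/-- One transition of `runTable`. -/
def stepTable (t : List (Option ℕ)) (s : ℕ × List ℕ) : ℕ × List ℕ :=
  s.2.casesOn s fun b τ => (t.getD (Nat.pair s.1 b) none).casesOn s fun q' => (q', τ)

theorem runTable_eq_iterate (t : List (Option ℕ)) (q : ℕ) (σ : List ℕ) :
    runTable t q σ = (stepTable t)^[σ.length] (q, σ) := by
  induction σ generalizing q with
  | nil => rfl
  | cons b τ ih =>
    rw [List.length_cons, Function.iterate_succ_apply, runTable]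
    cases h : t.getD (Nat.pair q b) none with
    | none =>
      have hs : stepTable t (q, b :: τ) = (q, b :: τ) := by simp only [stepTable, h]
      rw [hs, Function.iterate_fixed hs]
    | some q' =>
      have hs : stepTable t (q, b :: τ) = (q', τ) := by simp only [stepTable, h]
      rw [hs]
      exact ih q'

theorem primrec_stepTable (t : List (Option ℕ)) : Primrec (stepTable t) := by
  have h1 : Primrec₂ fun (s : ℕ × List ℕ) (a : ℕ × List ℕ) => t.getD (Nat.pair s.1 a.1) none :=
    (Primrec.list_getD (none : Option ℕ)).comp₂ (Primrec.const t).to₂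
      (Primrec₂.natPair.comp (Primrec.fst.comp Primrec.fst) (Primrec.fst.comp Primrec.snd)).to₂
  refine Primrec.list_casesOn (f := fun s : ℕ × List ℕ => s.2) (g := id)
    (h := fun s a => (t.getD (Nat.pair s.1 a.1) none).casesOn s fun q' => (q', a.2))
    Primrec.snd Primrec.id ?_
  refine (Primrec.option_casesOn (o := fun x : (ℕ × List ℕ) × ℕ × List ℕ =>
    t.getD (Nat.pair x.1.1 x.2.1) none) (f := fun x => x.1) (g := fun x q' => (q', x.2.2))
    h1 Primrec.fst ?_)
  exact (Primrec.pair Primrec.snd (Primrec.snd.comp (Primrec.snd.comp Primrec.fst))).to₂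

theorem primrec_runTable (t : List (Option ℕ)) (q : ℕ) : Primrec (runTable t q) := by
  have : runTable t q = fun σ => (stepTable t)^[σ.length] (q, σ) := by
    funext σ; exact runTable_eq_iterate t q σ
  rw [this]
  exact Primrec.nat_iterate Primrec.list_length (Primrec.pair (Primrec.const q) Primrec.id)
    ((primrec_stepTable t).comp Primrec.snd).to₂

theorem computable_of_finite_range {α : Type*} [Primcodable α] {g : ℕ → α} (hg : Computable g)
    (hfin : (Set.range g).Finite) {v : ℕ → Bool} (h : ∀ n n', g n = g n' → v n = v n') :
    Computable v := by
  obtain ⟨M, hM⟩ := (hfin.image Encodable.encode).bddAbove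
  let V : ℕ → Bool := fun m => decide (∃ n, Encodable.encode (g n) = m ∧ v n = true)
  have hv : v = fun n => ((List.range (M + 1)).map V).getD (Encodable.encode (g n)) false := by
    funext n
    have hn : Encodable.encode (g n) < M + 1 := Nat.lt_succ_of_le (hM ⟨_, ⟨n, rfl⟩, rfl⟩)
    have hV : V (Encodable.encode (g n)) = v n := by
      rw [Bool.eq_iff_iff]
      simp only [V, decide_eq_true_eq]
      refine ⟨?_, fun hn => ⟨n, rfl, hn⟩⟩
      rintro ⟨n', h1, h2⟩
      rw [← h n' n (Encodable.encode_injective h1), h2]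
    simp [List.getD, hn, hV]
  rw [hv]
  exact ((Primrec.list_getD false).comp (Primrec.const _) Primrec.id).to_comp.comp
    (Computable.encode.comp hg)

theorem countable_computable (α : Type*) [Primcodable α] : {f : ℕ → α | Computable f}.Countable := by
  rw [Set.countable_iff_exists_injOn]
  have hcode : ∀ f : ℕ → α, ∃ c : Nat.Partrec.Code, Computable f →
      ∀ n, c.eval n = Part.some (Encodable.encode (f n)) := by
    intro f
    by_cases hf : Computable f
    · obtain ⟨c, hc⟩ := Nat.Partrec.Code.exists_code.1 hf
      refine ⟨c, fun _ n => ?_⟩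
      rw [hc]
      simp [Part.bind_some, Part.map_some]
    · exact ⟨.zero, fun h => absurd h hf⟩
  choose c hc using hcode
  refine ⟨fun f => Encodable.encode (c f), fun f hf g hg h => ?_⟩
  have hfg : c f = c g := Encodable.encode_injective h
  funext n
  have h1 := hc f hf n
  rw [hfg, hc g hg n] at h1
  exact (Encodable.encode_injective (Part.some_inj.1 h1)).symm

section Tables

variable {X : Type*} {act : ℕ → X → X}

theorem exists_table {D : Set (X × ℕ)} (hD : D.Finite) (w : X) :
    ∃ (t : List (Option ℕ)) (N : Set X) (r : X → ℕ), Set.InjOn r N ∧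
      (∀ σ, (runOn act D w σ).1 ∈ N) ∧
      ∀ σ, runTable t (r w) σ = (r (runOn act D w σ).1, (runOn act D w σ).2) := by
  set N : Set X := insert w ((fun e => act e.2 e.1) '' D) with hN
  have hNfin : N.Finite := (hD.image _).insert _
  have htarget : ∀ e ∈ D, act e.2 e.1 ∈ N := fun e he => Or.inr ⟨e, he, rfl⟩
  obtain ⟨r, hr⟩ := Set.countable_iff_exists_injOn.1 hNfin.countable
  let V : ℕ → Option ℕ := fun m =>
    if h : ∃ e, e ∈ D ∧ e.1 ∈ N ∧ Nat.pair (r e.1) e.2 = m then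
      some (r (act h.choose.2 h.choose.1)) else none
  obtain ⟨M, hM⟩ := (hD.image fun e => Nat.pair (r e.1) e.2).bddAbove
  have hV1 : ∀ z b, z ∈ N → (z, b) ∈ D →
      ((List.range (M + 1)).map V).getD (Nat.pair (r z) b) none = some (r (act b z)) := by
    intro z b hz hzb
    have hlt : Nat.pair (r z) b < M + 1 := Nat.lt_succ_of_le (hM ⟨_, hzb, rfl⟩)
    have hex : ∃ e, e ∈ D ∧ e.1 ∈ N ∧ Nat.pair (r e.1) e.2 = Nat.pair (r z) b :=
      ⟨(z, b), hzb, hz, rfl⟩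
    have hVz : V (Nat.pair (r z) b) = some (r (act b z)) := by
      simp only [V, dif_pos hex]
      obtain ⟨-, h2, h3⟩ := hex.choose_spec
      obtain ⟨h4, h5⟩ := Nat.pair_eq_pair.1 h3
      rw [hr h2 hz h4, h5]
    simp [List.getD, hlt, hVz]
  have hV2 : ∀ z b, z ∈ N → (z, b) ∉ D →
      ((List.range (M + 1)).map V).getD (Nat.pair (r z) b) none = none := by
    intro z b hz hzb
    have hVz : V (Nat.pair (r z) b) = none := by
      refine dif_neg ?_
      rintro ⟨⟨z', b'⟩, h1, h2, h3⟩
      obtain ⟨h4, rfl⟩ := Nat.pair_eq_pair.1 h3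
      have hz' : z' = z := hr h2 hz h4
      exact hzb (hz' ▸ h1)
    by_cases hlt : Nat.pair (r z) b < M + 1
    · simp [List.getD, hlt, hVz]
    · simp [List.getD, hlt]
  refine ⟨(List.range (M + 1)).map V, N, r, hr, fun σ => runOn_fst_mem htarget (Or.inl rfl), ?_⟩
  have key : ∀ σ z, z ∈ N → runTable ((List.range (M + 1)).map V) (r z) σ =
      (r (runOn act D z σ).1, (runOn act D z σ).2) := by
    intro σ
    induction σ with
    | nil => intro z _; rfl
    | cons b σ ih =>
      intro z hz
      by_cases hzb : (z, b) ∈ D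
      · rw [runOn_cons_mem hzb, runTable, hV1 z b hz hzb]
        exact ih _ (htarget _ hzb)
      · rw [runOn_cons_notMem hzb, runTable, hV2 z b hz hzb]
  exact fun σ => key σ w (Or.inl rfl)

theorem foldl_eq_of_runOn_nil {D : Set (X × ℕ)} {w z : X} {σ : List ℕ}
    (h : runOn act D w σ = (z, [])) :
    σ.foldl (fun z b => act b z) w = z ∧ ∀ b ∈ σ, ∃ z, (z, b) ∈ D := by
  induction σ generalizing w with
  | nil =>
    simp only [runOn, Prod.mk.injEq, and_true] at h
    exact ⟨h, by simp⟩
  | cons b σ ih =>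
    by_cases hb : (w, b) ∈ D
    · rw [runOn_cons_mem hb] at h
      refine ⟨(ih h).1, fun a ha => ?_⟩
      rcases List.mem_cons.1 ha with rfl | ha
      · exact ⟨w, hb⟩
      · exact (ih h).2 a ha
    · rw [runOn_cons_notMem hb] at h
      simp at h

theorem exists_foldl_eq_runOn (D : Set (X × ℕ)) (w : X) (σ : List ℕ) :
    ∃ π : List ℕ, π.foldl (fun z b => act b z) w = (runOn act D w σ).1 := by
  induction σ generalizing w with
  | nil => exact ⟨[], rfl⟩
  | cons b σ ih =>
    by_cases hb : (w, b) ∈ D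
    · rw [runOn_cons_mem hb]
      obtain ⟨π, hπ⟩ := ih (act b w)
      exact ⟨b :: π, hπ⟩
    · rw [runOn_cons_notMem hb]
      exact ⟨[], rfl⟩

theorem runOn_rel {D : Set (X × ℕ)} {R : X → X → Prop} (hR : Equivalence R) (w : X) {σ : List ℕ}
    (h : ∀ e ∈ D, e.2 ∈ σ → R e.1 (act e.2 e.1)) : R w (runOn act D w σ).1 := by
  induction σ generalizing w with
  | nil => exact hR.refl _
  | cons b σ ih =>
    by_cases hb : (w, b) ∈ D
    · rw [runOn_cons_mem hb]
      exact hR.trans (h _ hb (by simp)) (ih _ fun e he hσ => h e he (by simp [hσ]))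
    · rw [runOn_cons_notMem hb]
      exact hR.refl _

end Tables

section Measurability

variable {act : ℕ → (ℕ → Bool) → ℕ → Bool}

theorem measurable_foldl (hact : ∀ b, Measurable (act b)) (π : List ℕ) :
    Measurable fun w => π.foldl (fun z b => act b z) w := by
  induction π with
  | nil => exact measurable_id
  | cons b π ih => exact ih.comp (hact b)

theorem measurableSet_runOn_eq (hact : ∀ b, Measurable (act b))
    {D : (ℕ → Bool) → Set ((ℕ → Bool) × ℕ)}
    (hD : ∀ u : (ℕ → Bool) → ℕ → Bool, Measurable u → ∀ b, MeasurableSet {w | (u w, b) ∈ D w})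
    {u : (ℕ → Bool) → ℕ → Bool} (hu : Measurable u) (τ σ : List ℕ) :
    ∀ u' : (ℕ → Bool) → ℕ → Bool, Measurable u' →
      MeasurableSet {w | runOn act (D w) (u' w) σ = (u w, τ)} := by
  induction σ with
  | nil =>
    intro u' hu'
    simp only [runOn, Prod.mk.injEq]
    exact measurableSet_and (measurableSet_eq_fun hu' hu) (MeasurableSet.const _)
  | cons b σ ih =>
    intro u' hu'
    have h1 := ih _ ((hact b).comp hu')
    have h2 : MeasurableSet {w | u' w = u w ∧ b :: σ = τ} :=
      measurableSet_and (measurableSet_eq_fun hu' hu) (MeasurableSet.const _)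
    convert (hD u' hu' b).ite h1 h2 using 1
    ext w
    by_cases hw : (u' w, b) ∈ D w
    · have : w ∈ {w | (u' w, b) ∈ D w} := hw
      rw [Set.mem_ofPred_eq, runOn_cons_mem hw]
      simp [Set.ite, hw]
    · rw [Set.mem_ofPred_eq, runOn_cons_notMem hw]
      simp [Set.ite, hw]

theorem measurableSet_stepClosure (hact : ∀ b, Measurable (act b)) (lvl : ℕ → ℕ)
    (p : ℕ → List ℕ × ℕ) (P i : ℕ) : ∀ u : (ℕ → Bool) → ℕ → Bool, Measurable u →
      ∀ b, MeasurableSet {w | (u w, b) ∈ stepClosure act lvl p P w i} := by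
  induction i with
  | zero => intro u _ b; simp [stepClosure]
  | succ i ih =>
    intro u hu b
    refine (ih u hu b).union (measurableSet_and (MeasurableSet.const (lvl b ≤ P)) ?_)
    have hinf : ∀ S : Set (List ℕ × ℕ), S.Infinite ↔ ∀ s : Finset (List ℕ × ℕ), ∃ θ, θ ∉ s ∧ θ ∈ S :=
      fun S => ⟨fun hS s => by
        obtain ⟨θ, h1, h2⟩ := hS.exists_notMem_finset s
        exact ⟨θ, h2, h1⟩, fun h hS => by
        obtain ⟨θ, h1, h2⟩ := h hS.toFinset
        exact h1 (hS.mem_toFinset.2 h2)⟩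
    simp only [hinf]
    refine measurableSet_forall fun s => measurableSet_exists fun θ =>
      measurableSet_and (MeasurableSet.const _) (measurableSet_exists fun n =>
        measurableSet_and ?_ (MeasurableSet.const _))
    exact measurableSet_runOn_eq hact ih hu _ _ _ measurable_id

end Measurability

/-- The level of a step; steps of level `n` move along the `n`-th subequivalence relation. -/
def stepLevel (b : ℕ) : ℕ := (Nat.unpair (Nat.unpair b).1).1

/-- The index of the function that a step applies. -/
def stepIndex (b : ℕ) : ℕ := (Nat.unpair (Nat.unpair b).1).2

/-- The conditions on the tails of positions against which the coloring diagonalizes. -/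
def tailConditions (J : Set ℕ) : Set (List ℕ → ℕ → ℕ → Prop) :=
  Set.range (fun b τ _ _ => τ.head? = some b) ∪ Set.range (fun θ τ h _ => (τ, h) = θ) ∪
    {fun τ _ _ => ∃ b ∉ J, τ.head? = some b, fun τ _ _ => τ = [], fun τ h n => τ = [] ∧ h ≠ n}

theorem countable_tailConditions (J : Set ℕ) : (tailConditions J).Countable :=
  ((Set.countable_range _).union (Set.countable_range _)).union (Set.toFinite _).countable

/-- The position in the coloring of the tail that a table leaves of the `n`-th position. -/
def tailCode (t : List (Option ℕ)) (q₀ : ℕ) (p : ℕ → List ℕ × ℕ) (n : ℕ) : ℕ :=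
  Encodable.encode ((runTable t q₀ (p n).1).2, (p n).2)

/-- The positions at which a table stops in state `q` with a tail that satisfies `C`. -/
def tailSet (t : List (Option ℕ)) (q₀ q : ℕ) (p : ℕ → List ℕ × ℕ)
    (C : List ℕ → ℕ → ℕ → Prop) : Set ℕ :=
  {n | (runTable t q₀ (p n).1).1 = q ∧ C (runTable t q₀ (p n).1).2 (p n).2 n}

/-- The code of the position with no steps and number `n`. -/
def baseCode (n : ℕ) : ℕ := Encodable.encode (([] : List ℕ), n)

/-- An enumeration of `w` and of the targets of the steps in `stepClosure`. -/
noncomputable def closureSeq {X : Type*} (act : ℕ → X → X) (p : ℕ → List ℕ × ℕ) (P : ℕ) (w : X)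
    (k : ℕ) : X :=
  if (((Denumerable.ofNat (List ℕ) (Nat.unpair k).1).foldl (fun z b => act b z) w,
      (Nat.unpair k).2) : X × ℕ) ∈ ⋃ i, stepClosure act stepLevel p P w i then
    act (Nat.unpair k).2 ((Denumerable.ofNat (List ℕ) (Nat.unpair k).1).foldl (fun z b => act b z) w)
  else w

/-- An enumeration of `x` and of the points at which, for some `i`, almost all of the step lists
`(p (Nat.pair i n)).1` end when started at `x`. -/
noncomputable def limitSeq {X : Type*} (act : ℕ → X → X) (p : ℕ → List ℕ × ℕ) (x : X)
    (k : ℕ) : X :=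
  if ∃ M, ∀ n ≥ M, (p (Nat.pair (Nat.unpair k).1 n)).1.foldl (fun z b => act b z) x =
      (Denumerable.ofNat (List ℕ) (Nat.unpair k).2).foldl (fun z b => act b z) x then
    (Denumerable.ofNat (List ℕ) (Nat.unpair k).2).foldl (fun z b => act b z) x
  else x

/-- The data from which the reduction is built: an enumeration `φ` of the classes of `E`, a set
`J` of usable steps, an exhaustion `F` of `E` and a generic family of colorings `c`. -/
structure Coding (E : (ℕ → Bool) → (ℕ → Bool) → Prop) where
  φ : ℕ → (ℕ → Bool) → ℕ → Bool
  measurable_φ : ∀ j, Measurable (φ j)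
  rel_iff_φ : ∀ x y, E x y ↔ ∃ j, φ j x = y
  J : Set ℕ
  exists_mem_J : ∀ m, ∃ b ∈ J, (Nat.unpair b).1 = m
  injOn_J : Set.InjOn (fun b => (Nat.unpair b).1) J
  heads_sdiff_J : ∀ t q₀ q, ∀ p : ℕ → List ℕ × ℕ, Computable p →
    {b | ∃ n τ, runTable t q₀ (p n).1 = (q, b :: τ)}.Infinite →
    ({b | ∃ n τ, runTable t q₀ (p n).1 = (q, b :: τ)} \ J).Infinite
  highSteps_not_subset_J : ∀ p, Computable p → (highSteps stepLevel p).Infinite →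
    ¬ highSteps stepLevel p ⊆ J
  recurrent_not_subset_J : ∀ p : ℕ → List ℕ × ℕ, Computable p →
    {b | ∃ i, {n | b ∈ (p (Nat.pair i n)).1}.Infinite}.Infinite →
    ¬ {b | ∃ i, {n | b ∈ (p (Nat.pair i n)).1}.Infinite} ⊆ J
  F : ℕ → (ℕ → Bool) → (ℕ → Bool) → Prop
  equivalence_F : ∀ n, Equivalence (F n)
  measurableSet_F : ∀ n, MeasurableSet {p : (ℕ → Bool) × (ℕ → Bool) | F n p.1 p.2}
  monotone_F : ∀ n a b, F n a b → F (n + 1) a b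
  rel_iff_F : ∀ a b, E a b ↔ ∃ n, F n a b
  closureSeq_not_subset : ∀ p, Computable p → ∀ P w,
    (Set.range (closureSeq (fun b => φ (stepIndex b)) p P w)).Infinite →
    ¬ Set.range (closureSeq (fun b => φ (stepIndex b)) p P w) ⊆ {y | F P w y}
  limitSeq_not_subset : ∀ p, Computable p → ∀ P x,
    (Set.range (limitSeq (fun b => φ (stepIndex b)) p x)).Infinite →
    ¬ Set.range (limitSeq (fun b => φ (stepIndex b)) p x) ⊆ {y | F P x y}
  c : (ℕ → Bool) → ℕ → Bool
  measurable_c : Measurable c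
  tail_generic : ∀ t q₀ q p, Computable p → ∀ C ∈ tailConditions J,
    (tailCode t q₀ p '' tailSet t q₀ q p C).Infinite →
    (∀ z j γ, ∃ n ∈ tailSet t q₀ q p C, xor (c z (tailCode t q₀ p n)) (φ j z n) = γ) ∧
    (∀ y z, y ≠ z → ∃ n ∈ tailSet t q₀ q p C, c y (baseCode n) ≠ c z (tailCode t q₀ p n)) ∧
    ∀ z, (∀ n ∈ tailSet t q₀ q p C, tailCode t q₀ p n ≠ baseCode n) →
      ∃ n ∈ tailSet t q₀ q p C, c z (baseCode n) ≠ c z (tailCode t q₀ p n)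
  const_generic : ∀ t q₀ q p, Computable p → ∀ C ∈ tailConditions J,
    (tailSet t q₀ q p C).Infinite → ∀ z γ, ∃ n ∈ tailSet t q₀ q p C, c z (baseCode n) = γ
  base_generic : ∀ ρ : ℕ → ℕ, Computable ρ → ∀ z j γ, ∃ n, xor (c z (baseCode n)) (φ j z (ρ n)) = γ
  base_injective : ∀ y z, y ≠ z → ∃ n, c y (baseCode n) ≠ c z (baseCode n)

theorem baseCode_injective : Function.Injective baseCode := fun n n' h => by
  simpa using Encodable.encode_injective h

theorem measurable_closureSeq {act : ℕ → (ℕ → Bool) → ℕ → Bool} (hact : ∀ b, Measurable (act b))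
    (p : ℕ → List ℕ × ℕ) (P : ℕ) : Measurable (closureSeq act p P) := by
  refine measurable_pi_lambda _ fun k => ?_
  have hu := measurable_foldl hact (Denumerable.ofNat (List ℕ) (Nat.unpair k).1)
  refine Measurable.ite ?_ ((hact _).comp hu) measurable_id
  simp only [Set.mem_iUnion]
  exact measurableSet_exists fun i => measurableSet_stepClosure hact stepLevel p P i _ hu _

theorem measurable_limitSeq {act : ℕ → (ℕ → Bool) → ℕ → Bool} (hact : ∀ b, Measurable (act b))
    (p : ℕ → List ℕ × ℕ) : Measurable (limitSeq act p) := by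
  refine measurable_pi_lambda _ fun k => ?_
  have hu := measurable_foldl hact (Denumerable.ofNat (List ℕ) (Nat.unpair k).2)
  refine Measurable.ite ?_ hu measurable_id
  exact measurableSet_exists fun M => measurableSet_forall fun n => measurableSet_forall fun _ =>
    measurableSet_eq_fun (measurable_foldl hact _) hu

theorem exists_coding {E : (ℕ → Bool) → (ℕ → Bool) → Prop} (hE : Equivalence E)
    (hEBorel : MeasurableSet {p : (ℕ → Bool) × (ℕ → Bool) | E p.1 p.2})
    (hEcount : ∀ x, {y | E x y}.Countable) (hEhyp : HyperBorelFinite E) : Nonempty (Coding E) := by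
  obtain ⟨φ, hφ, hEφ⟩ := exists_measurable_enumeration hE hEBorel hEcount
  let ι := {p : ℕ → List ℕ × ℕ // Computable p}
  have hι : Countable ι := (countable_computable (List ℕ × ℕ)).to_subtype
  have hι' : Countable {ρ : ℕ → ℕ // Computable ρ} := (countable_computable ℕ).to_subtype
  obtain ⟨s, hs⟩ := exists_column_section
    (Sum.elim (fun a : List (Option ℕ) × ℕ × ℕ × ι =>
        {b | ∃ n τ, runTable a.1 a.2.1 (a.2.2.2.1 n).1 = (a.2.2.1, b :: τ)})
      (Sum.elim (fun a : ι => highSteps stepLevel a.1)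
        fun a : ι => {b | ∃ i, {n | b ∈ (a.1 (Nat.pair i n)).1}.Infinite}))
  set J : Set ℕ := {b | (Nat.unpair b).2 = s (Nat.unpair b).1} with hJ
  have hκ : Countable (tailConditions J) := (countable_tailConditions J).to_subtype
  have hact : ∀ b, Measurable ((fun b => φ (stepIndex b)) b) := fun b => hφ _
  have hne : Nonempty (ι × ℕ ⊕ ι) := ⟨.inr ⟨fun _ => ([], 0), Computable.const _⟩⟩
  obtain ⟨enum, henum⟩ := exists_surjective_nat (ι × ℕ ⊕ ι)
  obtain ⟨F, hF1, hF2, hF3, hF4, hF5⟩ := hEhyp (fun i => (enum i).elim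
    (fun a => closureSeq (fun b => φ (stepIndex b)) a.1.1 a.2)
    (fun a => limitSeq (fun b => φ (stepIndex b)) a.1)) (fun i => by
      rcases enum i with a | a
      · exact measurable_closureSeq hact _ _
      · exact measurable_limitSeq hact _)
  obtain ⟨c, hc, hcgen⟩ := exists_coloring hφ baseCode_injective
    (Sum.elim (fun a : (List (Option ℕ) × ℕ × ℕ × ι) × tailConditions J =>
      tailSet a.1.1 a.1.2.1 a.1.2.2.1 a.1.2.2.2.1 a.2.1)
      fun _ : {ρ : ℕ → ℕ // Computable ρ} => Set.univ)
    (Sum.elim (fun a => tailCode a.1.1 a.1.2.1 a.1.2.2.2.1) fun _ => baseCode)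
    (Sum.elim (fun _ => id) fun ρ => ρ.1)
  have hbase : (baseCode '' Set.univ).Infinite :=
    Set.infinite_univ.image baseCode_injective.injOn
  refine ⟨{
    φ := φ
    measurable_φ := hφ
    rel_iff_φ := hEφ
    J := J
    exists_mem_J := fun m => ⟨Nat.pair m (s m), by simp [hJ], by simp⟩
    injOn_J := ?_
    heads_sdiff_J := fun t q₀ q p hp h => hs (.inl (t, q₀, q, ⟨p, hp⟩)) h
    highSteps_not_subset_J := fun p hp h hsub => hs (.inr (.inl ⟨p, hp⟩)) h ?_
    recurrent_not_subset_J := fun p hp h hsub => hs (.inr (.inr ⟨p, hp⟩)) h ?_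
    F := F
    equivalence_F := hF1
    measurableSet_F := hF2
    monotone_F := hF3
    rel_iff_F := hF4
    closureSeq_not_subset := fun p hp P w => ?_
    limitSeq_not_subset := fun p hp P x => ?_
    c := c
    measurable_c := hc
    tail_generic := fun t q₀ q p hp C hC h => ?_
    const_generic := fun t q₀ q p hp C hC h z γ => ?_
    base_generic := fun ρ hρ z j γ => ?_
    base_injective := fun y z hyz => ?_ }⟩
  · intro b hb b' hb' h
    have h1 : (Nat.unpair b).2 = s (Nat.unpair b).1 := hb
    have h2 : (Nat.unpair b').2 = s (Nat.unpair b').1 := hb'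
    simp only at h
    rw [← Nat.pair_unpair b, ← Nat.pair_unpair b', h1, h2, h]
  · exact Set.finite_empty.subset fun b hb => hb.2 (hsub hb.1)
  · exact Set.finite_empty.subset fun b hb => hb.2 (hsub hb.1)
  · obtain ⟨i, hi⟩ := henum (.inl (⟨p, hp⟩, P))
    simpa only [hi, Sum.elim_inl] using hF5 P w i
  · obtain ⟨i, hi⟩ := henum (.inr ⟨p, hp⟩)
    simpa only [hi, Sum.elim_inr] using hF5 P x i
  · obtain ⟨h1, h2, h3, -⟩ := hcgen (.inl ((t, q₀, q, ⟨p, hp⟩), ⟨C, hC⟩))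
    exact ⟨h1 h, h2 h, h3 h⟩
  · exact (hcgen (.inl ((t, q₀, q, ⟨p, hp⟩), ⟨C, hC⟩))).2.2.2 h z γ
  · obtain ⟨n, -, hn⟩ := (hcgen (.inr ⟨ρ, hρ⟩)).1 hbase z j γ
    exact ⟨n, hn⟩
  · obtain ⟨n, -, hn⟩ := (hcgen (.inr ⟨id, Computable.id⟩)).2.1 hbase y z hyz
    exact ⟨n, hn⟩

namespace Coding

variable {E : (ℕ → Bool) → (ℕ → Bool) → Prop} (S : Coding E)

/-- The action of a step. -/
def act (b : ℕ) : (ℕ → Bool) → ℕ → Bool := S.φ (stepIndex b)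

/-- The steps that the reduction follows. -/
def good : Set ((ℕ → Bool) × ℕ) :=
  {e | e.2 ∈ S.J ∧ S.F (stepLevel e.2) e.1 (S.act e.2 e.1) ∧
    ∀ j < stepIndex e.2, S.φ j e.1 ≠ S.act e.2 e.1}

/-- The value of the reduction at the position with steps `σ` and number `h`. -/
noncomputable def value (x : ℕ → Bool) (σ : List ℕ) (h : ℕ) : Bool :=
  S.c (runOn S.act S.good x σ).1 (Encodable.encode ((runOn S.act S.good x σ).2, h))

theorem rel_act (b : ℕ) (x : ℕ → Bool) : E x (S.act b x) :=
  (S.rel_iff_φ _ _).2 ⟨_, rfl⟩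

theorem value_cons_mem {x : ℕ → Bool} {b : ℕ} (hb : (x, b) ∈ S.good) (σ : List ℕ) (h : ℕ) :
    S.value x (b :: σ) h = S.value (S.act b x) σ h := by
  simp only [value, runOn_cons_mem hb]

theorem measurableSet_good (b : ℕ) : MeasurableSet {x | (x, b) ∈ S.good} := by
  have hb : Measurable (S.act b) := S.measurable_φ _
  refine measurableSet_and (MeasurableSet.const (b ∈ S.J)) (measurableSet_and ?_ ?_)
  · exact (measurable_id.prodMk hb) (S.measurableSet_F (stepLevel b))
  · have hne : ∀ j, MeasurableSet {x | S.φ j x ≠ S.act b x} := fun j =>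
      measurableSet_not (measurableSet_eq_fun (S.measurable_φ j) hb)
    have hall : MeasurableSet {x | ∀ j, j < stepIndex b → S.φ j x ≠ S.act b x} :=
      measurableSet_forall fun j => measurableSet_forall fun _ => hne j
    exact hall

theorem measurable_value (σ : List ℕ) (h : ℕ) : Measurable fun x => S.value x σ h := by
  have hc : ∀ m, Measurable fun x => S.c x m := fun m => (measurable_pi_apply m).comp S.measurable_c
  induction σ with
  | nil => exact hc (baseCode h)
  | cons b σ ih =>
    have hv : (fun x => S.value x (b :: σ) h) = fun x => if (x, b) ∈ S.good then
        S.value (S.act b x) σ h else S.c x (Encodable.encode (b :: σ, h)) := by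
      funext x
      split_ifs with hb
      · exact S.value_cons_mem hb σ h
      · simp only [value, runOn_cons_notMem hb]
    rw [hv]
    exact Measurable.ite (S.measurableSet_good b) (ih.comp (S.measurable_φ _)) (hc _)

theorem monotone_F' {m n : ℕ} (hmn : m ≤ n) {x y : ℕ → Bool} (h : S.F m x y) : S.F n x y := by
  induction hmn with
  | refl => exact h
  | step _ ih => exact S.monotone_F _ _ _ ih

theorem exists_good_step {x y : ℕ → Bool} (h : E x y) : ∃ b, (x, b) ∈ S.good ∧ S.act b x = y := by
  have hj := (S.rel_iff_φ x y).1 h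
  obtain ⟨n, hn⟩ := (S.rel_iff_F x y).1 h
  obtain ⟨b, hbJ, hb⟩ := S.exists_mem_J (Nat.pair n (Nat.find hj))
  have hlevel : stepLevel b = n := by simp [stepLevel, hb]
  have hindex : stepIndex b = Nat.find hj := by simp [stepIndex, hb]
  have hact : S.act b x = y := by
    rw [act, hindex]
    exact Nat.find_spec hj
  refine ⟨b, ⟨hbJ, ?_, fun j hjb => ?_⟩, hact⟩
  · simp only [hact, hlevel, hn]
  · simp only [hact]
    exact Nat.find_min hj (hindex ▸ hjb)

theorem injOn_good : Set.InjOn (fun e : (ℕ → Bool) × ℕ => (e.1, stepLevel e.2, S.act e.2 e.1))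
    S.good := by
  rintro ⟨z, b⟩ ⟨hb, -, hb'⟩ ⟨z', b'⟩ ⟨hc, -, hc'⟩ h
  simp only [Prod.mk.injEq] at h hb hb' hc hc'
  obtain ⟨rfl, h1, h2⟩ := h
  have hindex : stepIndex b = stepIndex b' := by
    rcases lt_trichotomy (stepIndex b) (stepIndex b') with hlt | heq | hgt
    · exact absurd h2 (hc' _ hlt)
    · exact heq
    · exact absurd h2.symm (hb' _ hgt)
  have hbb : b = b' := by
    refine S.injOn_J hb hc ?_
    simp only
    rw [← Nat.pair_unpair (Nat.unpair b).1, ← Nat.pair_unpair (Nat.unpair b').1]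
    exact congrArg₂ Nat.pair h1 hindex
  rw [hbb]

theorem finite_stepClosure {p : ℕ → List ℕ × ℕ} (hp : Computable p) (P : ℕ) (w : ℕ → Bool)
    (hU : (⋃ i, stepClosure S.act stepLevel p P w i) ⊆ S.good) :
    (⋃ i, stepClosure S.act stepLevel p P w i).Finite := by
  set U := ⋃ i, stepClosure S.act stepLevel p P w i with hUdef
  have hsub : ∀ i, stepClosure S.act stepLevel p P w i ⊆ U := fun i => Set.subset_iUnion _ i
  have hclo : ∀ e ∈ U, stepLevel e.2 ≤ P ∧ ∃ i σ, (runOn S.act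
      (stepClosure S.act stepLevel p P w i) w σ).1 = e.1 := by
    intro e he
    obtain ⟨i, hi⟩ := Set.mem_iUnion.1 he
    induction i with
    | zero => exact absurd hi (Set.notMem_empty _)
    | succ i ih =>
      rcases hi with hi | ⟨h1, h2⟩
      · exact ih hi
      · obtain ⟨θ, n, hn, -⟩ := h2.nonempty
        exact ⟨h1, i, (p n).1, by rw [hn]⟩
  have hF : ∀ e ∈ U, S.F P e.1 (S.act e.2 e.1) := fun e he =>
    S.monotone_F' (hclo e he).1 (hU he).2.1
  have hFw : ∀ e ∈ U, S.F P w (S.act e.2 e.1) := by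
    intro e he
    obtain ⟨-, i, σ, hσ⟩ := hclo e he
    refine (S.equivalence_F P).trans ?_ (hF e he)
    rw [← hσ]
    exact runOn_rel (S.equivalence_F P) w fun e he _ => hF e (hsub i he)
  have hrange : (Set.range (closureSeq S.act p P w)).Finite := by
    by_contra hinf
    have hnot : ¬ Set.range (closureSeq S.act p P w) ⊆ {y | S.F P w y} :=
      S.closureSeq_not_subset p hp P w (show Set.Infinite _ from hinf)
    refine hnot (Set.range_subset_iff.2 fun k => ?_)
    rw [closureSeq, Set.mem_ofPred_eq]
    split_ifs with hk
    · have hFk := hFw _ hk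
      exact hFk
    · exact (S.equivalence_F P).refl _
  have htarget : ∀ e ∈ U, S.act e.2 e.1 ∈ Set.range (closureSeq S.act p P w) := by
    rintro ⟨z, b⟩ he
    obtain ⟨-, i, σ, hσ⟩ := hclo _ he
    obtain ⟨π, hπ⟩ := exists_foldl_eq_runOn (act := S.act)
      (stepClosure S.act stepLevel p P w i) w σ
    have hz : π.foldl (fun z b => S.act b z) w = z := hπ.trans hσ
    refine ⟨Nat.pair (Encodable.encode π) b, ?_⟩
    simp only [closureSeq, Nat.unpair_pair, Denumerable.ofNat_encode, hz]
    exact if_pos he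
  have hsource : ∀ e ∈ U, e.1 ∈ insert w (Set.range (closureSeq S.act p P w)) := by
    intro e he
    obtain ⟨-, i, σ, hσ⟩ := hclo _ he
    rw [← hσ]
    exact runOn_fst_mem (fun e he => Or.inr (htarget e (hsub i he))) (Or.inl rfl)
  refine Set.Finite.of_injOn (fun e he => ?_) (S.injOn_good.mono hU)
    ((hrange.insert w).prod ((Set.finite_Iic P).prod hrange))
  exact ⟨hsource e he, (hclo e he).1, htarget e he⟩

/-- Positions whose values are separated from those of the coloring at `z` on every infinite
set of tails satisfying `C` leave only finitely many such tails at `z`. -/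
theorem finite_tails {D : Set ((ℕ → Bool) × ℕ)} (hDG : D ⊆ S.good) (hD : D.Finite)
    {p : ℕ → List ℕ × ℕ} {w z : ℕ → Bool} {v : ℕ → Bool}
    (hv : ∀ n, v n = S.value w (p n).1 (p n).2) {C : List ℕ → ℕ → ℕ → Prop}
    (hstuck : ∀ τ h n, C τ h n → runOn S.act S.good z τ = (z, τ))
    (hsep : ∀ t q₀ q, (tailCode t q₀ p '' tailSet t q₀ q p C).Infinite →
      (∃ n τ, runOn S.act D w (p n).1 = (z, τ)) →
      ∃ n ∈ tailSet t q₀ q p C, v n ≠ S.c z (tailCode t q₀ p n)) :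
    {θ : List ℕ × ℕ | ∃ n, runOn S.act D w (p n).1 = (z, θ.1) ∧ (p n).2 = θ.2 ∧
      C θ.1 θ.2 n}.Finite := by
  obtain ⟨t, N, r, hr, hN, ht⟩ := exists_table (act := S.act) hD w
  by_contra hinf
  obtain ⟨θ₀, n₀, hn₀, -⟩ := (show Set.Infinite _ from hinf).nonempty
  have hz : z ∈ N := by
    have := hN (p n₀).1
    rwa [hn₀] at this
  have himage : (tailCode t (r w) p '' tailSet t (r w) (r z) p C).Infinite := by
    refine (Set.Infinite.image (f := Encodable.encode) Encodable.encode_injective.injOn hinf).mono ?_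
    rintro _ ⟨⟨τ, h⟩, ⟨n, hn, rfl, hC⟩, rfl⟩
    refine ⟨n, ⟨by rw [ht, hn], ?_⟩, ?_⟩
    · rw [ht, hn]
      exact hC
    · rw [tailCode, ht, hn]
  obtain ⟨n, ⟨hn, hC⟩, hne⟩ := hsep t (r w) (r z) himage ⟨n₀, _, hn₀⟩
  rw [ht] at hn hC
  have hrun : (runOn S.act D w (p n).1).1 = z := hr (hN _) hz hn
  refine hne ?_
  rw [hv, value, ← runOn_trans hDG, hrun, hstuck _ _ _ hC, tailCode, ht]

theorem exists_finite_exceptions (hE : Equivalence E) {p : ℕ → List ℕ × ℕ} (hp : Computable p)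
    {w v : ℕ → Bool} (hv : ∀ n, v n = S.value w (p n).1 (p n).2) (Y : (ℕ → Bool) → Prop)
    (hsep : ∀ z, E w z → ∀ t q₀ q, ∀ C ∈ tailConditions S.J,
      (tailCode t q₀ p '' tailSet t q₀ q p C).Infinite →
      (Y z → ∀ n ∈ tailSet t q₀ q p C, tailCode t q₀ p n ≠ baseCode n) →
      ∃ n ∈ tailSet t q₀ q p C, v n ≠ S.c z (tailCode t q₀ p n)) :
    ∃ D ⊆ S.good, D.Finite ∧ {ξ : (ℕ → Bool) × List ℕ × ℕ | ∃ n,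
      runOn S.act D w (p n).1 = (ξ.1, ξ.2.1) ∧ (p n).2 = ξ.2.2 ∧
      ¬ (Y ξ.1 ∧ ξ.2.1 = [] ∧ ξ.2.2 = n)}.Finite := by
  have htails : ∀ D ⊆ S.good, D.Finite → ∀ z, ∀ C ∈ tailConditions S.J,
      (∀ τ h n, C τ h n → runOn S.act S.good z τ = (z, τ)) →
      (Y z → ∀ τ h n, C τ h n → ¬ (τ = [] ∧ h = n)) →
      {θ : List ℕ × ℕ | ∃ n, runOn S.act D w (p n).1 = (z, θ.1) ∧ (p n).2 = θ.2 ∧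
        C θ.1 θ.2 n}.Finite := by
    intro D hDG hD z C hC hstuck hY
    refine S.finite_tails hDG hD hv hstuck fun t q₀ q hinf hz => ?_
    obtain ⟨n, τ, hn⟩ := hz
    have hwz : E w z := by
      have := runOn_rel (act := S.act) (D := D) (σ := (p n).1) hE w
        fun e _ _ => S.rel_act e.2 e.1
      rwa [hn] at this
    refine hsep z hwz t q₀ q C hC hinf fun hYz n hn hcode => ?_
    have := Encodable.encode_injective hcode
    simp only [Prod.mk.injEq] at this
    exact hY hYz _ _ _ hn.2 this
  refine SlamanSteel.exists_finite_exceptions stepLevel p w S.good S.J Y (fun e he => he.1) ?_ ?_ ?_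
    (S.highSteps_not_subset_J p hp) (S.finite_stepClosure hp · w)
  · intro D hDG hD z b hzb
    refine Set.Finite.of_injOn (f := fun θ : List ℕ × ℕ => (b :: θ.1, θ.2)) ?_ ?_
      (htails D hDG hD z (fun τ _ _ => τ.head? = some b) (Or.inl (Or.inl ⟨b, rfl⟩)) ?_ ?_)
    · rintro ⟨τ, h⟩ ⟨n, h1, h2⟩
      exact ⟨n, h1, h2, rfl⟩
    · rintro ⟨τ, h⟩ - ⟨τ', h'⟩ - heq
      simpa using heq
    · rintro (_ | ⟨a, τ⟩) h n hC
      · rfl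
      · simp only [List.head?_cons, Option.some.injEq] at hC
        subst hC
        exact runOn_cons_notMem hzb
    · rintro - _ _ _ hC ⟨rfl, -⟩
      simp at hC
  · intro D hDG hD z
    by_contra hinf
    obtain ⟨t, N, r, hr, hN, ht⟩ := exists_table (act := S.act) hD w
    obtain ⟨b₀, n₀, τ₀, hn₀⟩ := (show Set.Infinite _ from hinf).nonempty
    have hz : z ∈ N := by
      have := hN (p n₀).1
      rwa [hn₀] at this
    have hset : {b | ∃ n τ, runTable t (r w) (p n).1 = (r z, b :: τ)} =
        {b | ∃ n τ, runOn S.act D w (p n).1 = (z, b :: τ)} := by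
      ext b
      refine exists_congr fun n => exists_congr fun τ => ?_
      rw [ht, Prod.ext_iff, Prod.ext_iff]
      exact and_congr_left fun _ => hr.eq_iff (hN _) hz
    have hinf' := S.heads_sdiff_J t (r w) (r z) p hp (by rw [hset]; exact hinf)
    rw [hset] at hinf'
    have hfin := htails D hDG hD z (fun τ _ _ => ∃ b ∉ S.J, τ.head? = some b)
      (Or.inr (Or.inl rfl)) ?_ ?_
    · refine hinf' ((hfin.image fun θ => θ.1.headD 0).subset ?_)
      rintro b ⟨⟨n, τ, hn⟩, hb⟩
      exact ⟨(b :: τ, (p n).2), ⟨n, hn, rfl, b, hb, rfl⟩, rfl⟩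
    · rintro (_ | ⟨a, τ⟩) h n hC
      · rfl
      · obtain ⟨b, hb, hab⟩ := hC
        simp only [List.head?_cons, Option.some.injEq] at hab
        subst hab
        exact runOn_cons_notMem fun hg => hb hg.1
    · rintro - _ _ _ ⟨b, -, hb⟩ ⟨rfl, -⟩
      simp at hb
  · intro D hDG hD z
    by_cases hY : Y z
    · refine ((htails D hDG hD z (fun τ h n => τ = [] ∧ h ≠ n) (Or.inr (Or.inr (Or.inr rfl))) ?_
        ?_).image Prod.snd).subset ?_
      · rintro _ _ _ ⟨rfl, -⟩
        rfl
      · rintro - _ _ _ ⟨-, h1⟩ ⟨-, h2⟩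
        exact h1 h2
      · rintro h ⟨n, h1, h2, h3⟩
        exact ⟨([], h), ⟨n, h1, h2, rfl, fun h4 => h3 ⟨hY, h4⟩⟩, rfl⟩
    · refine ((htails D hDG hD z (fun τ _ _ => τ = []) (Or.inr (Or.inr (Or.inl rfl))) ?_
        fun h => absurd h hY).image Prod.snd).subset ?_
      · rintro _ _ _ rfl
        rfl
      · rintro h ⟨n, h1, h2, -⟩
        exact ⟨([], h), ⟨n, h1, h2, rfl⟩, rfl⟩

end Coding

/-- The position that a natural number codes. -/
def decodePosition (a : ℕ) : List ℕ × ℕ := (Encodable.decode a).getD ([], 0)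

theorem decodePosition_encode (θ : List ℕ × ℕ) : decodePosition (Encodable.encode θ) = θ := by
  rw [decodePosition, Encodable.encodek, Option.getD_some]

theorem computable_decodePosition : Computable decodePosition :=
  Computable.option_getD Computable.decode (Computable.const _)

theorem computable_baseCode : Computable baseCode :=
  Computable.encode.comp ((Computable.const []).pair Computable.id)

theorem computable_natPair {f g : ℕ → ℕ} (hf : Computable f) (hg : Computable g) :
    Computable fun n => Nat.pair (f n) (g n) :=
  Primrec₂.natPair.to_comp.comp hf hg

theorem computable_unpair_fst : Computable fun n => (Nat.unpair n).1 :=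
  Computable.fst.comp Computable.unpair

theorem computable_unpair_snd : Computable fun n => (Nat.unpair n).2 :=
  Computable.snd.comp Computable.unpair

namespace Coding

variable {E : (ℕ → Bool) → (ℕ → Bool) → Prop} (S : Coding E)

/-- If the coloring at `u` on the codes of positions without steps is read off from values at
`w`, then the reading follows finitely many steps from `w` to `u` almost everywhere. -/
theorem exists_eventually_runOn_eq (hE : Equivalence E) {p : ℕ → List ℕ × ℕ} (hp : Computable p)
    {u w : ℕ → Bool} (hv : ∀ n, S.c u (baseCode n) = S.value w (p n).1 (p n).2) :
    ∃ D ⊆ S.good, D.Finite ∧ ∃ M, ∀ n ≥ M, runOn S.act D w (p n).1 = (u, []) := by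
  obtain ⟨D, hDG, hD, hfin⟩ := S.exists_finite_exceptions hE hp (v := fun n => S.c u (baseCode n))
    hv (· = u) (by
      intro z _ t q₀ q C hC hinf hY
      obtain ⟨-, h2, h3⟩ := S.tail_generic t q₀ q p hp C hC hinf
      by_cases hz : z = u
      · subst hz
        exact h3 z (hY rfl)
      · exact h2 u z (Ne.symm hz))
  refine ⟨D, hDG, hD, ?_⟩
  obtain ⟨t, N, r, hr, hN, ht⟩ := exists_table (act := S.act) hD w
  have hfiber : ∀ ξ : (ℕ → Bool) × List ℕ × ℕ,
      {n | runOn S.act D w (p n).1 = (ξ.1, ξ.2.1) ∧ (p n).2 = ξ.2.2}.Finite := by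
    rintro ⟨z, τ, h⟩
    by_contra hinf
    obtain ⟨n₀, hn₀, -⟩ := (show Set.Infinite _ from hinf).nonempty
    have hz : z ∈ N := by
      have := hN (p n₀).1
      rwa [hn₀] at this
    have hconst := S.const_generic t (r w) (r z) p hp (fun τ' h' _ => (τ', h') = (τ, h))
      (Or.inl (Or.inr ⟨(τ, h), rfl⟩)) (Set.Infinite.mono (fun n hn => ?_) hinf) u
        (!S.value z τ h)
    · obtain ⟨n, ⟨h1, h2⟩, h3⟩ := hconst
      rw [ht] at h1 h2
      have hrun : (runOn S.act D w (p n).1).1 = z := hr (hN _) hz h1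
      simp only [Prod.mk.injEq] at h2
      rw [hv, value, ← runOn_trans hDG, hrun, h2.1, h2.2] at h3
      simp [value] at h3
    · obtain ⟨h1, h2⟩ := hn
      simp only at h1 h2
      refine ⟨by rw [ht, h1], ?_⟩
      rw [ht, h1, h2]
  obtain ⟨M, hM⟩ := ((hfin.biUnion fun ξ _ => hfiber ξ)).bddAbove
  refine ⟨M + 1, fun n hn => ?_⟩
  by_contra hne
  have hle : n ≤ M := hM (Set.mem_biUnion (x := ((runOn S.act D w (p n).1).1,
    (runOn S.act D w (p n).1).2, (p n).2)) ⟨n, rfl, rfl, fun h => hne (Prod.ext h.1 h.2.1)⟩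
    ⟨rfl, rfl⟩)
  omega

/-- A real that is read off, up to complementation, from values at itself is computable. -/
theorem computable_of_eq_value (hE : Equivalence E) {p : ℕ → List ℕ × ℕ} (hp : Computable p)
    {x : ℕ → Bool} (ε : Bool) (hv : ∀ n, xor ε (x n) = S.value x (p n).1 (p n).2) :
    Computable x := by
  obtain ⟨D, hDG, hD, hfin⟩ := S.exists_finite_exceptions hE hp (v := fun n => xor ε (x n))
    hv (fun _ => False) (by
      intro z hxz t q₀ q C hC hinf _
      obtain ⟨j, hj⟩ := (S.rel_iff_φ z x).1 (hE.symm hxz)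
      obtain ⟨n, hn, h⟩ := (S.tail_generic t q₀ q p hp C hC hinf).1 z j (!ε)
      refine ⟨n, hn, fun heq => ?_⟩
      rw [← heq, hj] at h
      revert h
      cases ε <;> cases x n <;> simp)
  obtain ⟨t, N, r, hr, hN, ht⟩ := exists_table (act := S.act) hD x
  have hcomp : Computable fun n => xor ε (x n) := by
    refine computable_of_finite_range (g := fun n => (runTable t (r x) (p n).1, (p n).2))
      (((primrec_runTable t (r x)).to_comp.comp (Computable.fst.comp hp)).pair
        (Computable.snd.comp hp)) ?_ ?_
    · refine (hfin.image fun ξ => ((r ξ.1, ξ.2.1), ξ.2.2)).subset ?_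
      rintro _ ⟨n, rfl⟩
      exact ⟨((runOn S.act D x (p n).1).1, (runOn S.act D x (p n).1).2, (p n).2),
        ⟨n, rfl, rfl, fun h => h.1⟩, by simp only [ht]⟩
    · intro n n' h
      simp only [ht, Prod.mk.injEq] at h
      obtain ⟨⟨h1, h2⟩, h3⟩ := h
      rw [hv, hv, value, value, ← runOn_trans hDG, ← runOn_trans hDG x (p n').1,
        hr (hN _) (hN _) h1, h2, h3]
  have hx : x = fun n => xor ε (xor ε (x n)) := by
    funext n
    cases ε <;> simp
  rw [hx]
  exact (Primrec.dom_bool (xor ε)).to_comp.comp hcomp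

/-- No computable reading of values at `x` produces the colorings at infinitely many points. -/
theorem not_injective_of_eq_value (hE : Equivalence E) {p : ℕ → List ℕ × ℕ} (hp : Computable p)
    {x : ℕ → Bool} {xs : ℕ → ℕ → Bool} (hv : ∀ i n, S.c (xs i) (baseCode n) =
      S.value x (p (Nat.pair i n)).1 (p (Nat.pair i n)).2) : ¬ Function.Injective xs := by
  intro hxs
  choose D hDG hD M hM using fun i => S.exists_eventually_runOn_eq hE
    (hp.comp (computable_natPair (Computable.const i) Computable.id)) (hv i)
  have hfold := fun i n (hn : n ≥ M i) => foldl_eq_of_runOn_nil (hM i n hn)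
  set R : Set ℕ := {b | ∃ i, {n | b ∈ (p (Nat.pair i n)).1}.Infinite} with hRdef
  have hRJ : R ⊆ S.J := by
    rintro b ⟨i, hi⟩
    obtain ⟨n, hn, hMn⟩ := hi.exists_gt (M i)
    obtain ⟨z, hz⟩ := (hfold i n hMn.le).2 b hn
    exact (hDG i hz).1
  have hR : R.Finite := by
    by_contra hinf
    exact S.recurrent_not_subset_J p hp hinf hRJ
  obtain ⟨P, hP⟩ := (hR.image stepLevel).bddAbove
  have hF : ∀ i, S.F P x (xs i) := by
    intro i
    have hrare : (⋃ b ∈ Prod.snd '' D i \ R, {n | b ∈ (p (Nat.pair i n)).1}).Finite := by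
      refine (((hD i).image Prod.snd).subset Set.sdiff_subset).biUnion fun b hb => ?_
      by_contra hinf
      exact hb.2 ⟨i, hinf⟩
    obtain ⟨n, hn, hMn⟩ := hrare.infinite_compl.exists_gt (M i)
    have hrel := runOn_rel (act := S.act) (D := D i) (σ := (p (Nat.pair i n)).1)
      (S.equivalence_F P) x fun e he hσ => by
        have heR : e.2 ∈ R := by
          by_contra hno
          exact hn (Set.mem_biUnion ⟨⟨e, he, rfl⟩, hno⟩ hσ)
        exact S.monotone_F' (hP ⟨e.2, heR, rfl⟩) (hDG i he).2.1
    have hend := hM i n hMn.le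
    simp only [id] at hend
    rwa [hend] at hrel
  have hlim : ∀ i, xs i ∈ Set.range (limitSeq S.act p x) := by
    intro i
    refine ⟨Nat.pair i (Encodable.encode (p (Nat.pair i (M i))).1), ?_⟩
    have hMi := (hfold i (M i) le_rfl).1
    simp only [id] at hMi
    simp only [limitSeq, Nat.unpair_pair, Denumerable.ofNat_encode, hMi]
    exact if_pos ⟨M i, fun n hn => (hfold i n hn).1⟩
  have hinf : (Set.range (limitSeq S.act p x)).Infinite :=
    (Set.infinite_range_of_injective hxs).mono (Set.range_subset_iff.2 hlim)
  have hnot : ¬ Set.range (limitSeq S.act p x) ⊆ {y | S.F P x y} :=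
    S.limitSeq_not_subset p hp P x hinf
  refine hnot (Set.range_subset_iff.2 fun k => ?_)
  rw [limitSeq, Set.mem_ofPred_eq]
  split_ifs with hk
  · obtain ⟨M', hM'⟩ := hk
    rw [← hM' (max M' (M (Nat.unpair k).1)) (le_max_left _ _)]
    have hend := (hfold (Nat.unpair k).1 (max M' (M (Nat.unpair k).1)) (le_max_right _ _)).1
    simp only [id] at hend
    rw [hend]
    exact hF _
  · exact (S.equivalence_F P).refl _

/-- The reduction: its bits at `Nat.pair a t` are the values at the position coded by `a`. -/
noncomputable def reduction (x : ℕ → Bool) (m : ℕ) : Bool :=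
  S.value x (decodePosition (Nat.unpair m).1).1 (decodePosition (Nat.unpair m).1).2

theorem measurable_reduction : Measurable S.reduction :=
  measurable_pi_lambda _ fun _ => S.measurable_value _ _

theorem reduction_base (x : ℕ → Bool) (n : ℕ) :
    S.reduction x (Nat.pair (baseCode n) 0) = S.c x (baseCode n) := by
  simp only [reduction, Nat.unpair_pair, baseCode, decodePosition_encode]
  rfl

theorem reduction_injective : Function.Injective S.reduction := by
  intro x y h
  by_contra hxy
  obtain ⟨n, hn⟩ := S.base_injective x y hxy
  rw [← S.reduction_base, ← S.reduction_base, h] at hn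
  exact hn rfl

theorem reduction_oneLE {x y : ℕ → Bool} (h : E y x) : OneLE (S.reduction x) (S.reduction y) := by
  obtain ⟨b, hb, hbx⟩ := S.exists_good_step h
  have hdec : Computable fun m : ℕ => decodePosition (Nat.unpair m).1 :=
    computable_decodePosition.comp computable_unpair_fst
  refine ⟨fun m => Nat.pair (Encodable.encode (b :: (decodePosition (Nat.unpair m).1).1,
    (decodePosition (Nat.unpair m).1).2)) m, ?_, fun m m' hm => (Nat.pair_eq_pair.1 hm).2,
    fun m => ?_⟩
  · refine computable_natPair (Computable.encode.comp (Computable.pair ?_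
      (Computable.snd.comp hdec))) Computable.id
    exact Computable.list_cons.comp (Computable.const b) (Computable.fst.comp hdec)
  · simp only [reduction, Nat.unpair_pair, decodePosition_encode]
    rw [S.value_cons_mem hb, hbx]

theorem rel_of_reduction_mle (hE : Equivalence E) {x y : ℕ → Bool}
    (h : MLE (S.reduction x) (S.reduction y)) : E x y := by
  obtain ⟨ρ, hρ, hxy⟩ := h
  obtain ⟨D, -, -, M, hM⟩ := S.exists_eventually_runOn_eq hE
    (p := fun n => decodePosition (Nat.unpair (ρ (Nat.pair (baseCode n) 0))).1)
    (computable_decodePosition.comp (computable_unpair_fst.comp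
      (hρ.comp (computable_natPair computable_baseCode (Computable.const 0)))))
    (u := x) (w := y) fun n => by rw [← S.reduction_base, hxy]; rfl
  have hrel := runOn_rel (act := S.act) (D := D)
    (σ := (decodePosition (Nat.unpair (ρ (Nat.pair (baseCode M) 0))).1).1) hE y
    fun e _ _ => S.rel_act e.2 e.1
  rw [hM M le_rfl] at hrel
  exact hE.symm hrel

theorem reduction_ne_comp (hE : Equivalence E) (x : ℕ → Bool) (ε : Bool) {ρ : ℕ → ℕ}
    (hρ : Computable ρ) : ¬ ∀ m, S.reduction x m = xor ε (x (ρ m)) := by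
  intro h
  obtain ⟨j, hj⟩ := (S.rel_iff_φ x x).1 (hE.refl x)
  obtain ⟨n, hn⟩ := S.base_generic (fun n => ρ (Nat.pair (baseCode n) 0))
    (hρ.comp (computable_natPair computable_baseCode (Computable.const 0))) x j (!ε)
  rw [← S.reduction_base, h, hj] at hn
  revert hn
  cases ε <;> cases x (ρ (Nat.pair (baseCode n) 0)) <;> simp

theorem computable_of_eq_reduction_comp (hE : Equivalence E) {x : ℕ → Bool} (ε : Bool)
    {ρ : ℕ → ℕ} (hρ : Computable ρ) (h : ∀ n, xor ε (x n) = S.reduction x (ρ n)) :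
    Computable x :=
  S.computable_of_eq_value hE
    (computable_decodePosition.comp (computable_unpair_fst.comp hρ)) ε h

theorem not_joinSeq_reduction_mle (hE : Equivalence E) {x : ℕ → Bool} {xs : ℕ → ℕ → Bool}
    (hxs : Function.Injective xs) :
    ¬ MLE (joinSeq fun i => S.reduction (xs i)) (S.reduction x) := by
  rintro ⟨ρ, hρ, h⟩
  refine S.not_injective_of_eq_value hE (x := x) (p := fun m => decodePosition (Nat.unpair
    (ρ (Nat.pair (Nat.unpair m).1 (Nat.pair (baseCode (Nat.unpair m).2) 0)))).1) ?_
    (fun i n => ?_) hxs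
  · exact computable_decodePosition.comp (computable_unpair_fst.comp (hρ.comp
      (computable_natPair computable_unpair_fst (computable_natPair
        (computable_baseCode.comp computable_unpair_snd) (Computable.const 0)))))
  · have := h (Nat.pair i (Nat.pair (baseCode n) 0))
    simp only [joinSeq, Nat.unpair_pair, S.reduction_base] at this
    simp only [Nat.unpair_pair]
    exact this

end Coding

/-- Suppose `E` is a hyper-Borel-finite countable Borel equivalence relation on
`2^ω`. Then there exists an injective Borel function `f : 2^ω → 2^ω` such that:
(1) if `x_0 E x_1`, then `f(x_0) ≡₁ f(x_1)`; (2) if `¬(x_0 E x_1)`, then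
`¬(f(x_0) ≡_m f(x_1))`; (3) for every noncomputable `x`, `f(x)` is
`≤_m`-incomparable with both `x` and its complement `x̄`; and (4) for every `x`,
there is no infinite sequence `(x_i)` of distinct elements of `[x]_E` with
`f(x) ≥_m ⊕_i f(x_i)`. -/
theorem main_construction
    (E : (ℕ → Bool) → (ℕ → Bool) → Prop) (hE : Equivalence E)
    (hEBorel : MeasurableSet {p : (ℕ → Bool) × (ℕ → Bool) | E p.1 p.2})
    (hEcount : ∀ x, {y | E x y}.Countable)
    (hEhyp : HyperBorelFinite E) :
    ∃ f : (ℕ → Bool) → ℕ → Bool, Measurable f ∧ Function.Injective f ∧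
      (∀ x₀ x₁, E x₀ x₁ → OneEquiv (f x₀) (f x₁)) ∧
      (∀ x₀ x₁, ¬ E x₀ x₁ → ¬ MEquiv (f x₀) (f x₁)) ∧
      (∀ x, ¬ Computable x →
        ¬ MLE (f x) x ∧ ¬ MLE x (f x) ∧
        ¬ MLE (f x) (flipBits x) ∧ ¬ MLE (flipBits x) (f x)) ∧
      (∀ x, ¬ ∃ xs : ℕ → ℕ → Bool, Function.Injective xs ∧
        (∀ i, E x (xs i)) ∧ MLE (joinSeq fun i => f (xs i)) (f x)) := by
  obtain ⟨S⟩ := exists_coding hE hEBorel hEcount hEhyp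
  refine ⟨S.reduction, S.measurable_reduction, S.reduction_injective,
    fun x y h => ⟨S.reduction_oneLE (hE.symm h), S.reduction_oneLE h⟩,
    fun x y h hxy => h (S.rel_of_reduction_mle hE hxy.1), fun x hx => ⟨?_, ?_, ?_, ?_⟩,
    fun x ⟨xs, hxs, _, h⟩ => S.not_joinSeq_reduction_mle hE hxs h⟩
  · rintro ⟨ρ, hρ, h⟩
    exact S.reduction_ne_comp hE x false hρ fun m => by rw [h, Bool.false_xor]
  · rintro ⟨ρ, hρ, h⟩
    exact hx (S.computable_of_eq_reduction_comp hE false hρ fun n => by rw [Bool.false_xor, h])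
  · rintro ⟨ρ, hρ, h⟩
    exact S.reduction_ne_comp hE x true hρ fun m => by rw [h, Bool.true_xor]; rfl
  · rintro ⟨ρ, hρ, h⟩
    exact hx (S.computable_of_eq_reduction_comp hE true hρ fun n => by
      rw [← h, Bool.true_xor]; rfl)

end SlamanSteel
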